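/- arXiv:1902.05989 — 3 statements merged into one kernel-verified Lean document; each statement's English description precedes it below -/
import Mathlib

section
/- For every positive integer k there is a constant C_k > 0 with the following property. Let p be a prime, let 𝒰, 𝒱 ⊆ 𝔽_p be subsets of cardinalities U = #𝒰 and V = #𝒱, let a : 𝒰 → ℂ and b : 𝒱 → ℂ be arbitrary complex weights with |a_u| ≤ A for all u ∈ 𝒰 and |b_v| ≤ B for all v ∈ 𝒱, and let x, y ∈ 𝔽_p with y ≠ 0. Then |∑_{u ∈ 𝒰} ∑_{v ∈ 𝒱} a_u·b_v·ψ_{x,y;p}(u+v)| ≤ C_k·A·B·U^{1−1/(2k)}·(V^{1/2}·p^{1/(2k)} + V·p^{1/(4k)}). -/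
/-- `ψ_{x,y;p}(u) = e_p(x·u + y·u⁻¹)` for `u ≠ 0` and `ψ_{x,y;p}(0) = 0`. -/
noncomputable def psi (p : ℕ) (x y u : ZMod p) : ℂ :=
  if u = 0 then 0
  else Complex.exp (2 * Real.pi * Complex.I * ((x * u + y * u⁻¹).val : ℂ) / (p : ℂ))

section

open Polynomial

/-- A sum of blocks `s e * (X - α)^(m e) * w e` with `deg s e < m` and `w e` nonvanishing at `α`
vanishes only if every `s e` does. -/
lemma eq_zero_of_sum_mul_pow_mul_eq_zero {F : Type*} [Field F] (α : F) (m N : ℕ) (s w : ℕ → F[X])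
    (hs : ∀ e < N, (s e).degree < m) (hw : ∀ e < N, (w e).eval α ≠ 0)
    (h : ∑ e ∈ Finset.range N, s e * (X - C α) ^ (m * e) * w e = 0) :
    ∀ e < N, s e = 0 := by
  induction N generalizing s w with
  | zero => intro e he; omega
  | succ N ih =>
    rw [Finset.sum_range_succ'] at h
    have hfac : ∑ e ∈ Finset.range N, s (e + 1) * (X - C α) ^ (m * (e + 1)) * w (e + 1)
        = (X - C α) ^ m * ∑ e ∈ Finset.range N, s (e + 1) * (X - C α) ^ (m * e) * w (e + 1) := by
      rw [Finset.mul_sum]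
      refine Finset.sum_congr rfl fun e _ => ?_
      ring
    rw [hfac] at h
    have hcop : IsCoprime ((X - C α) ^ m) (w 0) := by
      refine IsCoprime.pow_left ?_
      rw [(irreducible_X_sub_C α).coprime_iff_not_dvd, dvd_iff_isRoot]
      exact hw 0 (by omega)
    have hdvd : (X - C α) ^ m ∣ s 0 * w 0 := by
      simp only [mul_zero, pow_zero, mul_one] at h
      exact ⟨-_, by rw [mul_neg]; exact eq_neg_of_add_eq_zero_right h⟩
    have h0 : s 0 = 0 := by
      refine eq_zero_of_dvd_of_degree_lt (hcop.dvd_of_dvd_mul_right hdvd) ?_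
      rw [degree_pow, degree_X_sub_C, nsmul_one]
      exact hs 0 (by omega)
    rw [h0, zero_mul, zero_mul, add_zero] at h
    have h' := (mul_eq_zero.mp h).resolve_left (pow_ne_zero _ (X_sub_C_ne_zero α))
    have := ih (fun e => s (e + 1)) (fun e => w (e + 1)) (fun e he => hs _ (by omega))
      (fun e he => hw _ (by omega)) h'
    rintro (_ | e) he
    · exact h0
    · exact this e (by omega)

/-- The numerator of `∑_{t ≤ ν} (P / Q)^(p^t)` over the denominator `Q^(p^ν)`. -/
noncomputable def traceNumerator {F : Type*} [Field F] (p : ℕ) (P Q : F[X]) (ν : ℕ) : F[X] :=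
  ∑ t ∈ Finset.range (ν + 1), P ^ p ^ t * Q ^ (p ^ ν - p ^ t)

lemma natDegree_traceNumerator_le {F : Type*} [Field F] {p : ℕ} (hp : 0 < p) {P Q : F[X]} {r : ℕ}
    (hP : P.natDegree ≤ r) (hQ : Q.natDegree ≤ r) (ν : ℕ) :
    (traceNumerator p P Q ν).natDegree ≤ p ^ ν * r := by
  refine natDegree_sum_le_of_forall_le _ _ fun t ht => ?_
  have hle : p ^ t ≤ p ^ ν := Nat.pow_le_pow_right hp (by simpa [Nat.lt_succ_iff] using ht)
  calc (P ^ p ^ t * Q ^ (p ^ ν - p ^ t)).natDegree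
      ≤ p ^ t * r + (p ^ ν - p ^ t) * r := by
        refine natDegree_mul_le.trans (Nat.add_le_add ?_ ?_)
        · exact natDegree_pow_le.trans (Nat.mul_le_mul_left _ hP)
        · exact natDegree_pow_le.trans (Nat.mul_le_mul_left _ hQ)
    _ = p ^ ν * r := by rw [← add_mul, Nat.add_sub_cancel' hle]

lemma eval_traceNumerator_of_eval_eq_zero {F : Type*} [Field F] {p : ℕ} (hp : 1 < p) {P Q : F[X]}
    {α : F} (hQ : Q.eval α = 0) (ν : ℕ) :
    (traceNumerator p P Q ν).eval α = P.eval α ^ p ^ ν := by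
  rw [traceNumerator, Finset.sum_range_succ, eval_add, eval_finsetSum, Finset.sum_eq_zero]
  · simp
  · intro t ht
    have : p ^ t < p ^ ν := Nat.pow_lt_pow_right hp (by simpa using ht)
    simp [hQ, zero_pow (Nat.sub_ne_zero_of_lt this)]

lemma aeval_traceNumerator {F K : Type*} [Field F] [Field K] [Algebra F K] {p : ℕ} (hp : 0 < p)
    {P Q : F[X]} {x : K} (hQ : aeval x Q ≠ 0) (ν : ℕ) :
    aeval x (traceNumerator p P Q ν)
      = aeval x Q ^ p ^ ν * ∑ t ∈ Finset.range (ν + 1), (aeval x P / aeval x Q) ^ p ^ t := by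
  rw [traceNumerator, map_sum, Finset.mul_sum]
  refine Finset.sum_congr rfl fun t ht => ?_
  have hle : p ^ t ≤ p ^ ν := Nat.pow_le_pow_right hp (by simpa [Nat.lt_succ_iff] using ht)
  rw [map_mul, map_pow, map_pow, div_pow, pow_sub₀ _ hQ hle]
  field_simp

/-- A homogeneous linear condition count: there is a nontrivial family of polynomials of degree
less than `m` whose `q`-expansions satisfy a given polynomial relation. -/
lemma exists_sum_expand_mul_eq_zero {F : Type*} [Field F] (q m N D B : ℕ) (R : ℕ → F[X])
    (hq : 0 < q) (hR : ∀ e < N, (R e).natDegree ≤ B) (hD : m * q + B ≤ D)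
    (hlt : D < N * m) :
    ∃ s : ℕ → F[X], (∀ e, (s e).degree < m) ∧ (∃ e < N, s e ≠ 0) ∧
      ∑ e ∈ Finset.range N, expand F q (s e) * R e = 0 := by
  let Φ₀ : (Fin N → degreeLT F m) →ₗ[F] F[X] :=
    ∑ e : Fin N, (LinearMap.mulRight F (R e)) ∘ₗ (expand F q).toLinearMap ∘ₗ
      (degreeLT F m).subtype ∘ₗ LinearMap.proj e
  have hΦ₀ : ∀ s, Φ₀ s = ∑ e : Fin N, expand F q (s e : F[X]) * R e := by
    intro s
    simp [Φ₀]
  have hmem : ∀ s, Φ₀ s ∈ degreeLT F D := by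
    intro s
    rw [hΦ₀]
    refine Submodule.sum_mem _ fun e _ => ?_
    rw [mem_degreeLT]
    by_cases h0 : (s e : F[X]) = 0
    · simp [h0]
    refine lt_of_le_of_lt degree_le_natDegree ?_
    have h1 : (s e : F[X]).natDegree < m :=
      (natDegree_lt_iff_degree_lt h0).2 (mem_degreeLT.1 (s e).2)
    have h2 : (expand F q (s e : F[X]) * R e).natDegree < D := by
      refine lt_of_le_of_lt natDegree_mul_le ?_
      rw [natDegree_expand]
      have := hR e e.2
      have := Nat.mul_lt_mul_of_pos_right h1 hq
      omega
    exact_mod_cast h2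
  let Φ : (Fin N → degreeLT F m) →ₗ[F] degreeLT F D := Φ₀.codRestrict _ hmem
  have hfin : ∀ n, Module.finrank F (degreeLT F n) = n := fun n => by
    rw [(degreeLTEquiv F n).finrank_eq, Module.finrank_fin_fun]
  have : ∀ n, Module.Finite F (degreeLT F n) := fun n =>
    Module.Finite.equiv (degreeLTEquiv F n).symm
  have hker : LinearMap.ker Φ ≠ ⊥ := by
    apply LinearMap.ker_ne_bot_of_finrank_lt
    rw [Module.finrank_pi_fintype]
    simp [hfin, hlt]
  obtain ⟨s, hs, hs0⟩ := Submodule.exists_mem_ne_zero_of_ne_bot hker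
  have hz : Φ₀ s = 0 := by
    have := congrArg Subtype.val (LinearMap.mem_ker.1 hs)
    simpa [Φ] using this
  refine ⟨fun e => if h : e < N then (s ⟨e, h⟩ : F[X]) else 0, fun e => ?_, ?_, ?_⟩
  · by_cases h : e < N
    · simpa [h] using mem_degreeLT.1 (s ⟨e, h⟩).2
    · simp [h]
  · by_contra! hall
    refine hs0 (funext fun e => Subtype.ext ?_)
    simpa using hall e e.2
  · rw [Finset.sum_range, ← hz, hΦ₀]
    simp

/-- Stepanov's method: over a field of `p^(μ+ν+2)` elements, the value set count of
`x ↦ Tr (P x / Q x)` exceeds the expected one by at most a constant times `p^(ν+1)`. -/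
lemma card_trace_eq_le {p : ℕ} [Fact p.Prime] {K : Type*} [Field K] [Fintype K] [DecidableEq K]
    [Algebra (ZMod p) K] {P Q Q₁ : (ZMod p)[X]} {α : ZMod p} {r μ ν : ℕ}
    (hQ : Q = (X - C α) * Q₁) (hQ₁ : Q₁.eval α ≠ 0) (hP : P.eval α ≠ 0)
    (hPr : P.natDegree ≤ r) (hQr : Q.natDegree ≤ r) (hμν : μ ≤ ν) (hr : r + 3 ≤ p ^ (μ + 1))
    (hK : Fintype.card K = p ^ (μ + ν + 2)) (a : ZMod p) :
    (Finset.univ.filter fun x : K => aeval x Q ≠ 0 ∧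
      ∑ t ∈ Finset.range (μ + ν + 2), (aeval x P / aeval x Q) ^ p ^ t
        = algebraMap (ZMod p) K a).card ≤ p ^ (μ + ν + 1) + (2 * r + 3) * p ^ (ν + 1) := by
  have hp : p.Prime := Fact.out
  have : CharP K p := charP_of_injective_algebraMap (algebraMap (ZMod p) K).injective p
  have : ExpChar K p := ExpChar.prime hp
  set l := p ^ μ with hl
  set m := p ^ ν with hm
  have hlm : l ≤ m := Nat.pow_le_pow_right hp.pos hμν
  have hl0 : 0 < l := pow_pos hp.pos _
  have hm0 : 0 < m := pow_pos hp.pos _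
  have hp2 := hp.two_le
  have hplm : p * l ≤ p * m := Nat.mul_le_mul_left _ hlm
  have h2l : 2 * l ≤ p * l := Nat.mul_le_mul_right _ hp2
  have hr' : r + 3 ≤ p * l := by rw [hl, ← pow_succ']; exact hr
  set I := l + r + 2 with hI
  obtain ⟨p', hpp'⟩ : ∃ p', p = p' + 1 := ⟨p - 1, by omega⟩
  have hQα : Q.eval α = 0 := by simp [hQ]
  let R : ℕ → (ZMod p)[X] := fun e =>
    (X - C α) ^ (e / p) * (Q ^ l) ^ (e % p) * traceNumerator p P Q μ ^ (p' - e % p)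
  have hR : ∀ e < I * p, (R e).natDegree ≤ I + l * r * p := by
    intro e he
    have he1 : e / p < I := Nat.div_lt_of_lt_mul (by rwa [mul_comm])
    have he2 : e % p < p := Nat.mod_lt _ hp.pos
    have d1 : ((X - C α : (ZMod p)[X]) ^ (e / p)).natDegree ≤ I := by
      rw [natDegree_pow, natDegree_X_sub_C]; omega
    have d2 : ((Q ^ l) ^ (e % p)).natDegree ≤ (e % p) * (l * r) := by
      rw [natDegree_pow, natDegree_pow]
      gcongr
    have d3 : (traceNumerator p P Q μ ^ (p' - e % p)).natDegree ≤ (p' - e % p) * (l * r) := by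
      rw [natDegree_pow]
      gcongr
      exact natDegree_traceNumerator_le hp.pos hPr hQr μ
    have d4 : (e % p) * (l * r) + (p' - e % p) * (l * r) ≤ l * r * p := by
      rw [← add_mul, mul_comm]
      gcongr
      omega
    have h1 := natDegree_mul_le (p := (X - C α) ^ (e / p) * (Q ^ l) ^ (e % p))
      (q := traceNumerator p P Q μ ^ (p' - e % p))
    have h2 := natDegree_mul_le (p := (X - C α) ^ (e / p)) (q := (Q ^ l) ^ (e % p))
    simp only [R]
    omega
  obtain ⟨s, hs, ⟨e₀, he₀, hse₀⟩, hsum⟩ := exists_sum_expand_mul_eq_zero (p ^ (μ + 1)) m (I * p)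
    (m * p ^ (μ + 1) + (I + l * r * p)) (I + l * r * p) R (pow_pos hp.pos _) hR le_rfl (by
      rw [pow_succ, ← hl, hI]
      have : l * r * p ≤ m * r * p := by gcongr
      nlinarith [this, hplm, h2l, hr'])
  let T : (ZMod p)[X] := C a * Q ^ m - traceNumerator p P Q ν
  let H : (ZMod p)[X] := ∑ e ∈ Finset.range (I * p),
    s e * (X - C α) ^ (m * e) * ((Q₁ ^ m) ^ (e % p) * T ^ (p' - e % p))
  have hT : T.eval α ≠ 0 := by
    simp only [T, eval_sub, eval_mul, eval_pow, hQα, zero_pow hm0.ne', mul_zero, zero_sub,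
      eval_traceNumerator_of_eval_eq_zero hp.one_lt hQα]
    exact neg_ne_zero.2 (pow_ne_zero _ hP)
  have hH0 : H ≠ 0 := fun h0 => hse₀ <| eq_zero_of_sum_mul_pow_mul_eq_zero α m (I * p) s _
    (fun e _ => hs e) (fun e _ => by
      rw [eval_mul, eval_pow, eval_pow, eval_pow]
      exact mul_ne_zero (pow_ne_zero _ (pow_ne_zero _ hQ₁)) (pow_ne_zero _ hT)) h0 e₀ he₀
  have hH : H = ∑ e ∈ Finset.range (I * p),
      s e * (X - C α) ^ (e / p * (p * m)) * ((Q ^ m) ^ (e % p) * T ^ (p' - e % p)) := by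
    refine Finset.sum_congr rfl fun e _ => ?_
    have he : m * e = e / p * (p * m) + m * (e % p) := by
      conv_lhs => rw [← Nat.div_add_mod e p]
      ring
    rw [he, hQ, mul_pow, mul_pow, pow_add, pow_mul _ m (e % p)]
    ring
  have hTdeg : T.natDegree ≤ m * r := by
    refine (natDegree_sub_le _ _).trans (max_le ?_ ?_)
    · refine natDegree_mul_le.trans ?_
      rw [natDegree_C, zero_add, natDegree_pow]
      gcongr
    · exact natDegree_traceNumerator_le hp.pos hPr hQr ν
  have hHdeg : H.natDegree ≤ m + I * (p * m) + m * r * p := by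
    rw [hH]
    refine natDegree_sum_le_of_forall_le _ _ fun e he => ?_
    have he1 : e / p < I := Nat.div_lt_of_lt_mul (by rw [mul_comm]; simpa using he)
    have he2 : e % p < p := Nat.mod_lt _ hp.pos
    have d0 : (s e).natDegree ≤ m := natDegree_le_of_degree_le (hs e).le
    have d1 : ((X - C α : (ZMod p)[X]) ^ (e / p * (p * m))).natDegree ≤ I * (p * m) := by
      rw [natDegree_pow, natDegree_X_sub_C, mul_one]
      gcongr
    have d2 : ((Q ^ m) ^ (e % p)).natDegree ≤ (e % p) * (m * r) := by
      rw [natDegree_pow, natDegree_pow]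
      gcongr
    have d3 : (T ^ (p' - e % p)).natDegree ≤ (p' - e % p) * (m * r) := by
      rw [natDegree_pow]
      gcongr
    have d4 : (e % p) * (m * r) + (p' - e % p) * (m * r) ≤ m * r * p := by
      rw [← add_mul, mul_comm]
      gcongr
      omega
    have h1 := natDegree_mul_le (p := s e * (X - C α) ^ (e / p * (p * m)))
      (q := (Q ^ m) ^ (e % p) * T ^ (p' - e % p))
    have h2 := natDegree_mul_le (p := s e) (q := (X - C α) ^ (e / p * (p * m)))
    have h3 := natDegree_mul_le (p := (Q ^ m) ^ (e % p)) (q := T ^ (p' - e % p))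
    omega
  have hzero : ∀ x : K, aeval x Q ≠ 0 → ∑ t ∈ Finset.range (μ + ν + 2),
      (aeval x P / aeval x Q) ^ p ^ t = algebraMap (ZMod p) K a → aeval x H = 0 := by
    intro x hxQ hx
    set f := aeval x P / aeval x Q
    set A := algebraMap (ZMod p) K a
    set Gμ := ∑ t ∈ Finset.range (μ + 1), f ^ p ^ t with hGμ
    set Gν := ∑ t ∈ Finset.range (ν + 1), f ^ p ^ t with hGν
    have hA : A ^ p ^ (μ + 1) = A := by
      rw [← map_pow, ZMod.pow_card_pow]
    have hG : Gμ = (A - Gν) ^ p ^ (μ + 1) := by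
      rw [sub_pow_char_pow, hA, hGν, sum_pow_char_pow, eq_sub_iff_add_eq, ← hx,
        show μ + ν + 2 = (μ + 1) + (ν + 1) by ring, Finset.sum_range_add _ (μ + 1)]
      refine congrArg (Gμ + ·) (Finset.sum_congr rfl fun t _ => ?_)
      rw [← pow_mul, ← pow_add, add_comm t]
    have hsx : ∀ e, aeval x (expand (ZMod p) (p ^ (μ + 1)) (s e)) =
        aeval x (s e) ^ p ^ (μ + 1) := by
      intro e
      rw [expand_aeval]
      have := map_aeval_eq_aeval_map (φ := RingHom.id (ZMod p))
        (ψ := iterateFrobenius K p (μ + 1)) (Subsingleton.elim _ _) (s e) x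
      simpa [iterateFrobenius_def] using this.symm
    have hxq : (x - algebraMap (ZMod p) K α) ^ p ^ (μ + ν + 2) = x - algebraMap (ZMod p) K α := by
      rw [← hK, FiniteField.pow_card]
    have e1 : aeval x (∑ e ∈ Finset.range (I * p), expand (ZMod p) (p ^ (μ + 1)) (s e) * R e)
        = (aeval x Q ^ l) ^ p' * ∑ e ∈ Finset.range (I * p), aeval x (s e) ^ p ^ (μ + 1) *
          (x - algebraMap (ZMod p) K α) ^ (e / p) * Gμ ^ (p' - e % p) := by
      rw [map_sum, Finset.mul_sum]
      refine Finset.sum_congr rfl fun e _ => ?_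
      have he2 : e % p < p := Nat.mod_lt _ hp.pos
      simp only [R, map_mul, map_pow, hsx, map_sub, aeval_X, aeval_C,
        aeval_traceNumerator hp.pos hxQ, mul_pow (_ ^ p ^ μ) _ (p' - e % p)]
      rw [← hGμ, ← hl]
      have : (aeval x Q ^ l) ^ p' = (aeval x Q ^ l) ^ (e % p) * (aeval x Q ^ l) ^ (p' - e % p) := by
        rw [← pow_add]; congr 1; omega
      rw [this]
      ring
    have e2 : aeval x H = (aeval x Q ^ m) ^ p' * ∑ e ∈ Finset.range (I * p), aeval x (s e) *
          (x - algebraMap (ZMod p) K α) ^ (e / p * (p * m)) * (A - Gν) ^ (p' - e % p) := by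
      rw [hH, map_sum, Finset.mul_sum]
      refine Finset.sum_congr rfl fun e _ => ?_
      have he2 : e % p < p := Nat.mod_lt _ hp.pos
      have hTx : aeval x T = aeval x Q ^ m * (A - Gν) := by
        simp only [T, map_sub, map_mul, map_pow, aeval_C, aeval_traceNumerator hp.pos hxQ]
        ring
      have : (aeval x Q ^ m) ^ p' = (aeval x Q ^ m) ^ (e % p) * (aeval x Q ^ m) ^ (p' - e % p) := by
        rw [← pow_add]; congr 1; omega
      simp only [map_mul, map_pow, map_sub, aeval_X, aeval_C, hTx, mul_pow (_ ^ m) _ (p' - e % p)]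
      rw [this]
      ring
    rw [hsum, map_zero] at e1
    have e3 := (mul_eq_zero.1 e1.symm).resolve_left (pow_ne_zero _ (pow_ne_zero _ hxQ))
    rw [e2]
    refine mul_eq_zero_of_right _ (pow_eq_zero_iff (pow_pos hp.pos (μ + 1)).ne' |>.1 ?_)
    rw [sum_pow_char_pow, ← e3]
    refine Finset.sum_congr rfl fun e _ => ?_
    rw [mul_pow, mul_pow, hG, pow_right_comm (A - Gν), ← pow_mul _ _ (p ^ (μ + 1)),
      show e / p * (p * m) * p ^ (μ + 1) = p ^ (μ + ν + 2) * (e / p) by rw [hm]; ring,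
      pow_mul _ (p ^ (μ + ν + 2)), hxq]
  have hsub : (Finset.univ.filter fun x : K => aeval x Q ≠ 0 ∧
      ∑ t ∈ Finset.range (μ + ν + 2), (aeval x P / aeval x Q) ^ p ^ t
        = algebraMap (ZMod p) K a) ⊆ (H.aroots K).toFinset := by
    intro x hx
    simp only [Finset.mem_filter, Finset.mem_univ, true_and] at hx
    rw [Multiset.mem_toFinset, mem_aroots]
    exact ⟨hH0, hzero x hx.1 hx.2⟩
  calc _ ≤ (H.aroots K).toFinset.card := Finset.card_le_card hsub
    _ ≤ Multiset.card (H.aroots K) := Multiset.toFinset_card_le _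
    _ ≤ H.natDegree := (card_roots' _).trans (natDegree_map_le)
    _ ≤ _ := hHdeg
    _ ≤ p ^ (μ + ν + 1) + (2 * r + 3) * p ^ (ν + 1) := by
      rw [show p ^ (μ + ν + 1) = l * (p * m) by rw [hl, hm]; ring,
        show p ^ (ν + 1) = p * m by rw [hm]; ring, hI]
      have : m ≤ p * m := Nat.le_mul_of_pos_left _ hp.pos
      nlinarith

lemma finite_monic_natDegree_eq (F : Type*) [Field F] [Finite F] (n : ℕ) :
    {g : F[X] | g.Monic ∧ g.natDegree = n}.Finite := by
  have : Finite (degreeLT F (n + 1)) := Finite.of_equiv _ (degreeLTEquiv F (n + 1)).symm.toEquiv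
  refine (Set.toFinite (degreeLT F (n + 1) : Set F[X])).subset fun g hg => ?_
  rw [SetLike.mem_coe, mem_degreeLT]
  refine lt_of_le_of_lt degree_le_natDegree ?_
  rw [hg.2]
  exact_mod_cast Nat.lt_succ_self n

/-- The monic polynomials of degree `n` over a finite field. -/
noncomputable def monicsOfDegree (F : Type*) [Field F] [Finite F] (n : ℕ) : Finset F[X] :=
  (finite_monic_natDegree_eq F n).toFinset

lemma mem_monicsOfDegree {F : Type*} [Field F] [Finite F] {n : ℕ} {g : F[X]} :
    g ∈ monicsOfDegree F n ↔ g.Monic ∧ g.natDegree = n := by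
  simp [monicsOfDegree]

open Classical in
/-- The monic irreducible polynomials of degree `n` over a finite field. -/
noncomputable def irreduciblesOfDegree (F : Type*) [Field F] [Finite F] (n : ℕ) : Finset F[X] :=
  (monicsOfDegree F n).filter Irreducible

lemma mem_irreduciblesOfDegree {F : Type*} [Field F] [Finite F] {n : ℕ} {g : F[X]} :
    g ∈ irreduciblesOfDegree F n ↔ (g.Monic ∧ g.natDegree = n) ∧ Irreducible g := by
  simp [irreduciblesOfDegree, mem_monicsOfDegree]

open Classical in
lemma natDegree_eq_sum_pow_dvd {F : Type*} [Field F] [Finite F] {n : ℕ} {g : F[X]}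
    (hg : g ∈ monicsOfDegree F n) :
    n = ∑ d ∈ Finset.Icc 1 n, ∑ P ∈ irreduciblesOfDegree F d, ∑ j ∈ Finset.Icc 1 n,
      if P ^ j ∣ g then d else 0 := by
  obtain ⟨hm, hn⟩ := mem_monicsOfDegree.1 hg
  have hg0 := hm.ne_zero
  set N := UniqueFactorizationMonoid.normalizedFactors g with hN
  have hNirr : ∀ P ∈ N, P.Monic ∧ Irreducible P ∧ P ∣ g := fun P hP =>
    ⟨by
      have h1 := UniqueFactorizationMonoid.normalize_normalized_factor P hP
      have h2 := (UniqueFactorizationMonoid.irreducible_of_normalized_factor P hP).ne_zero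
      rw [← h1]; exact monic_normalize h2,
      UniqueFactorizationMonoid.irreducible_of_normalized_factor P hP,
      UniqueFactorizationMonoid.dvd_of_mem_normalizedFactors hP⟩
  have hprod : N.prod = g := by
    have h := UniqueFactorizationMonoid.prod_normalizedFactors hg0
    have hmonic := monic_multiset_prod_of_monic N id fun P hP => (hNirr P hP).1
    rw [Multiset.map_id] at hmonic
    exact eq_of_monic_of_associated hmonic hm h
  have hcount : ∀ P : F[X], P.Monic → Irreducible P → ∀ j, P ^ j ∣ g ↔ j ≤ N.count P := by
    intro P hP hirr j
    have h := UniqueFactorizationMonoid.emultiplicity_eq_count_normalizedFactors hirr hg0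
    rw [hP.normalize_eq_self] at h
    rw [pow_dvd_iff_le_emultiplicity, h]
    exact_mod_cast Iff.rfl
  have hdeg : n = (N.map natDegree).sum := by
    rw [← hn, ← natDegree_multiset_prod_of_monic _ fun P hP => (hNirr P hP).1, hprod]
  have hcn : ∀ P, P.Monic → Irreducible P → N.count P ≤ n := by
    intro P hP hirr
    have h1 := natDegree_le_of_dvd ((hcount P hP hirr _).2 le_rfl) hg0
    rw [natDegree_pow, hn] at h1
    exact (Nat.le_mul_of_pos_right _ hirr.natDegree_pos).trans h1
  have hinner : ∀ d, ∀ P ∈ irreduciblesOfDegree F d, (∑ j ∈ Finset.Icc 1 n,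
      if P ^ j ∣ g then d else 0) = N.count P * P.natDegree := by
    intro d P hP
    obtain ⟨⟨hP1, rfl⟩, hP2⟩ := mem_irreduciblesOfDegree.1 hP
    rw [← Finset.sum_filter, Finset.sum_const, smul_eq_mul]
    congr 1
    have : (Finset.Icc 1 n).filter (fun j => P ^ j ∣ g) = Finset.Icc 1 (N.count P) := by
      ext j
      simp only [Finset.mem_filter, Finset.mem_Icc, hcount P hP1 hP2]
      have := hcn P hP1 hP2
      omega
    rw [this, Nat.card_Icc, Nat.add_sub_cancel]
  rw [Finset.sum_congr rfl fun d _ => Finset.sum_congr rfl (hinner d), Finset.sum_sigma']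
  conv_lhs => rw [hdeg, Finset.sum_multiset_map_count]
  simp only [smul_eq_mul]
  refine Finset.sum_of_injOn (fun P => ⟨P.natDegree, P⟩) ?_ ?_ ?_ fun P _ => rfl
  · intro P _ R _ h
    exact congrArg (fun x : (_ : ℕ) × F[X] => x.2) h
  · intro P hP
    obtain ⟨h1, h2, h3⟩ := hNirr P (Multiset.mem_toFinset.1 hP)
    simp only [Finset.coe_sigma, Set.mem_sigma_iff, Finset.mem_coe, Finset.mem_Icc]
    refine ⟨⟨h2.natDegree_pos, ?_⟩, mem_irreduciblesOfDegree.2 ⟨⟨h1, rfl⟩, h2⟩⟩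
    rw [← hn]
    exact natDegree_le_of_dvd h3 hg0
  · rintro ⟨d, P⟩ hx hnot
    have hP : P.natDegree = d := (mem_irreduciblesOfDegree.1 (Finset.mem_sigma.1 hx).2).1.2
    subst hP
    have : P ∉ N := fun hP => hnot ⟨P, by simpa using hP, rfl⟩
    simp [Multiset.count_eq_zero_of_notMem this]

open Classical in
lemma sum_monics_pow_dvd {F : Type*} [Field F] [Finite F] (lam : F[X] →* ℂ) (n d j : ℕ) {P : F[X]}
    (hP : P ∈ irreduciblesOfDegree F d) :
    (∑ g ∈ monicsOfDegree F n, if P ^ j ∣ g then lam g else 0) =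
      if d * j ≤ n then lam P ^ j * ∑ g ∈ monicsOfDegree F (n - d * j), lam g else 0 := by
  obtain ⟨⟨hP1, rfl⟩, hP2⟩ := mem_irreduciblesOfDegree.1 hP
  have hdeg : (P ^ j).natDegree = P.natDegree * j := by rw [natDegree_pow, mul_comm]
  split_ifs with hle
  · rw [← Finset.sum_filter, Finset.mul_sum]
    symm
    refine Finset.sum_nbij (fun h => P ^ j * h) ?_ ?_ ?_ ?_
    · intro h hh
      obtain ⟨h1, h2⟩ := mem_monicsOfDegree.1 hh
      refine Finset.mem_filter.2 ⟨mem_monicsOfDegree.2 ⟨(hP1.pow j).mul h1, ?_⟩, dvd_mul_right _ _⟩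
      rw [(hP1.pow j).natDegree_mul h1, hdeg, h2]
      omega
    · intro h _ h' _ he
      exact mul_left_cancel₀ (hP1.pow j).ne_zero he
    · intro g hg
      obtain ⟨hg, h, rfl⟩ := Finset.mem_filter.1 hg
      obtain ⟨h1, h2⟩ := mem_monicsOfDegree.1 hg
      have h3 := (hP1.pow j).of_mul_monic_left h1
      refine ⟨h, mem_monicsOfDegree.2 ⟨h3, ?_⟩, rfl⟩
      rw [(hP1.pow j).natDegree_mul h3, hdeg] at h2
      omega
    · intro h _
      rw [map_mul, map_pow]
  · refine Finset.sum_eq_zero fun g hg => if_neg fun hd => hle ?_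
    obtain ⟨h1, h2⟩ := mem_monicsOfDegree.1 hg
    rw [← h2, ← hdeg]
    exact natDegree_le_of_dvd hd h1.ne_zero

/-- The weight of prime powers of degree `m`, i.e. the `m`-th coefficient of the logarithmic
derivative of the `L`-function of `lam`. -/
noncomputable def primePowerSum {F : Type*} [Field F] [Finite F] (lam : F[X] →* ℂ) (m : ℕ) : ℂ :=
  ∑ x ∈ m.divisorsAntidiagonal, ∑ P ∈ irreduciblesOfDegree F x.1, (x.1 : ℂ) * lam P ^ x.2

lemma natCast_mul_sum_monics {F : Type*} [Field F] [Finite F] (lam : F[X] →* ℂ) (n : ℕ) :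
    (n : ℂ) * ∑ g ∈ monicsOfDegree F n, lam g = ∑ x ∈ Finset.HasAntidiagonal.antidiagonal n,
      primePowerSum lam x.1 * ∑ g ∈ monicsOfDegree F x.2, lam g := by
  classical
  have h1 : (n : ℂ) * ∑ g ∈ monicsOfDegree F n, lam g =
      ∑ d ∈ Finset.Icc 1 n, ∑ j ∈ Finset.Icc 1 n, ∑ P ∈ irreduciblesOfDegree F d,
        if d * j ≤ n then
          d * lam P ^ j * ∑ g ∈ monicsOfDegree F (n - d * j), lam g else 0 := by
    calc (n : ℂ) * ∑ g ∈ monicsOfDegree F n, lam g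
        = ∑ g ∈ monicsOfDegree F n, ∑ d ∈ Finset.Icc 1 n, ∑ j ∈ Finset.Icc 1 n,
          ∑ P ∈ irreduciblesOfDegree F d, d * (if P ^ j ∣ g then lam g else 0) := by
          rw [Finset.mul_sum]
          refine Finset.sum_congr rfl fun g hg => ?_
          conv_lhs => rw [natDegree_eq_sum_pow_dvd hg]
          push_cast
          rw [Finset.sum_mul]
          refine Finset.sum_congr rfl fun d _ => ?_
          rw [Finset.sum_comm, Finset.sum_mul]
          refine Finset.sum_congr rfl fun j _ => ?_
          rw [Finset.sum_mul]
          refine Finset.sum_congr rfl fun P _ => ?_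
          split_ifs <;> simp
      _ = _ := by
          rw [Finset.sum_comm]
          refine Finset.sum_congr rfl fun d _ => ?_
          rw [Finset.sum_comm]
          refine Finset.sum_congr rfl fun j _ => ?_
          rw [Finset.sum_comm]
          refine Finset.sum_congr rfl fun P hP => ?_
          rw [← Finset.mul_sum, sum_monics_pow_dvd lam n d j hP]
          split_ifs
          · ring
          · simp
  rw [h1, Finset.Nat.sum_antidiagonal_eq_sum_range_succ_mk]
  simp only [primePowerSum, Finset.sum_mul]
  rw [Finset.sum_sigma' (Finset.range n.succ), ← Finset.sum_product']
  have h2 : ∀ x : ℕ × ℕ, (∑ P ∈ irreduciblesOfDegree F x.1, if x.1 * x.2 ≤ n then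
          x.1 * lam P ^ x.2 * ∑ g ∈ monicsOfDegree F (n - x.1 * x.2), lam g else 0) =
          if x.1 * x.2 ≤ n then ∑ P ∈ irreduciblesOfDegree F x.1,
          x.1 * lam P ^ x.2 * ∑ g ∈ monicsOfDegree F (n - x.1 * x.2), lam g else 0 := by
    intro x
    split_ifs <;> simp
  simp only [h2]
  rw [← Finset.sum_filter]
  refine Finset.sum_nbij' (fun x => ⟨x.1 * x.2, x⟩) (fun y => y.2) ?_ ?_ ?_ ?_ ?_
  · rintro ⟨d, j⟩ h
    simp only [Finset.mem_filter, Finset.mem_product, Finset.mem_Icc] at h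
    simp only [Finset.mem_sigma, Finset.mem_range, Nat.mem_divisorsAntidiagonal]
    exact ⟨by omega, trivial, (Nat.mul_pos h.1.1.1 h.1.2.1).ne'⟩
  · rintro ⟨m, d, j⟩ h
    simp only [Finset.mem_sigma, Finset.mem_range, Nat.mem_divisorsAntidiagonal] at h
    simp only [Finset.mem_filter, Finset.mem_product, Finset.mem_Icc]
    obtain ⟨h, rfl, h0⟩ := h
    have hd : 0 < d := Nat.pos_of_ne_zero (left_ne_zero_of_mul h0)
    have hj : 0 < j := Nat.pos_of_ne_zero (right_ne_zero_of_mul h0)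
    have := Nat.le_mul_of_pos_left j hd
    have := Nat.le_mul_of_pos_right d hj
    omega
  · intro x _
    rfl
  · rintro ⟨m, d, j⟩ h
    simp only [Finset.mem_sigma, Nat.mem_divisorsAntidiagonal] at h
    obtain ⟨_, rfl, _⟩ := h
    rfl
  · intro x _
    rfl

lemma hasSum_coeff_mul_pow (B : ℂ[X]) (z : ℂ) : HasSum (fun n => B.coeff n * z ^ n) (B.eval z) := by
  rw [eval_eq_sum_range]
  refine hasSum_sum_of_ne_finset_zero fun n hn => ?_
  rw [coeff_eq_zero_of_natDegree_lt (by simpa using hn), zero_mul]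

lemma summable_norm_coeff_mul_pow (B : ℂ[X]) (z : ℂ) : Summable fun n => ‖B.coeff n * z ^ n‖ := by
  refine summable_of_ne_finset_zero (s := Finset.range (B.natDegree + 1)) fun n hn => ?_
  rw [coeff_eq_zero_of_natDegree_lt (by simpa using hn), zero_mul, norm_zero]

/-- If the logarithmic derivative `X L' / L` has coefficients `O(ρ^n)`, then `L` has no zeros in
the disc of radius `1 / ρ`. -/
lemma one_le_mul_norm_of_isRoot {L : ℂ[X]} {S : ℕ → ℂ} {ρ M : ℝ} (hL : L.coeff 0 = 1)
    (hrec : ∀ n : ℕ, (n : ℂ) * L.coeff n =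
      ∑ x ∈ Finset.HasAntidiagonal.antidiagonal n, S x.1 * L.coeff x.2)
    (hS : ∀ n, ‖S n‖ ≤ M * ρ ^ n) (hρ : 0 < ρ) {z : ℂ} (hz : L.IsRoot z) : 1 ≤ ρ * ‖z‖ := by
  by_contra! hlt
  have hL0 : L ≠ 0 := by rintro rfl; simp at hL
  have hz0 : z ≠ 0 := by
    rintro rfl
    rw [IsRoot.def, ← coeff_zero_eq_eval_zero, hL] at hz
    exact one_ne_zero hz
  obtain ⟨H, hH, hnd⟩ := exists_eq_pow_rootMultiplicity_mul_and_not_dvd L hL0 z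
  have hHz : H.eval z ≠ 0 := fun h => hnd (dvd_iff_isRoot.2 h)
  obtain ⟨m, hm⟩ : ∃ m, L.rootMultiplicity z = m + 1 :=
    Nat.exists_eq_succ_of_ne_zero ((rootMultiplicity_pos hL0).2 hz).ne'
  rw [hm] at hH
  set B₁ : ℂ[X] := (X - C z) * H with hB₁
  set B₂ : ℂ[X] := X * (((m + 1 : ℕ) : ℂ[X]) * H + (X - C z) * derivative H) with hB₂
  have e1 : L = (X - C z) ^ m * B₁ := by rw [hH, hB₁]; ring
  have e2 : X * derivative L = (X - C z) ^ m * B₂ := by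
    rw [hH, derivative_mul, derivative_X_sub_C_pow, hB₂, Nat.add_sub_cancel]
    simp only [Nat.cast_add, Nat.cast_one, C_add, C_1, map_natCast]
    ring
  have e3 : PowerSeries.mk S * (L : PowerSeries ℂ) =
      ((X * derivative L : ℂ[X]) : PowerSeries ℂ) := by
    ext n
    rw [PowerSeries.coeff_mul, Polynomial.coeff_coe]
    simp only [PowerSeries.coeff_mk, Polynomial.coeff_coe]
    rw [← hrec n]
    cases n with
    | zero => simp
    | succ n => rw [coeff_X_mul, coeff_derivative]; push_cast; ring
  have e4 : PowerSeries.mk S * (B₁ : PowerSeries ℂ) = (B₂ : PowerSeries ℂ) := by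
    have hne : (((X - C z) ^ m : ℂ[X]) : PowerSeries ℂ) ≠ 0 := by
      rw [Ne, Polynomial.coe_eq_zero_iff]
      exact pow_ne_zero _ (X_sub_C_ne_zero z)
    refine mul_left_cancel₀ hne ?_
    rw [← Polynomial.coe_mul _ B₂, ← e2, ← e3, mul_left_comm, ← Polynomial.coe_mul, ← e1]
  have hsumm : Summable fun n => ‖S n * z ^ n‖ := by
    refine Summable.of_nonneg_of_le (fun _ => norm_nonneg _) (fun n => ?_)
      ((summable_geometric_of_lt_one (by positivity) hlt).mul_left M)
    rw [norm_mul, norm_pow, mul_pow, ← mul_assoc]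
    gcongr
    exact hS n
  have e5 := tsum_mul_tsum_eq_tsum_sum_antidiagonal_of_summable_norm hsumm
    (summable_norm_coeff_mul_pow B₁ z)
  rw [(hasSum_coeff_mul_pow B₁ z).tsum_eq] at e5
  have e6 : ∀ n, ∑ x ∈ Finset.HasAntidiagonal.antidiagonal n,
      S x.1 * z ^ x.1 * (B₁.coeff x.2 * z ^ x.2) = B₂.coeff n * z ^ n := by
    intro n
    have := congrArg (PowerSeries.coeff n) e4
    rw [PowerSeries.coeff_mul, Polynomial.coeff_coe] at this
    rw [← this, Finset.sum_mul]
    refine Finset.sum_congr rfl fun x hx => ?_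
    rw [← Finset.HasAntidiagonal.mem_antidiagonal.1 hx, PowerSeries.coeff_mk, Polynomial.coeff_coe]
    ring
  simp only [e6] at e5
  rw [(hasSum_coeff_mul_pow B₂ z).tsum_eq] at e5
  have : B₂.eval z = z * ((m + 1 : ℕ) * H.eval z) := by simp [hB₂]
  rw [this] at e5
  simp only [hB₁, eval_mul, eval_sub, eval_X, eval_C, sub_self, zero_mul, mul_zero] at e5
  exact mul_ne_zero hz0 (mul_ne_zero (by exact_mod_cast m.succ_ne_zero) hHz) e5.symm

lemma norm_coeff_one_le {L : ℂ[X]} {S : ℕ → ℂ} {D : ℕ} {ρ M : ℝ} (hL : L.coeff 0 = 1)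
    (hD : L.natDegree ≤ D)
    (hrec : ∀ n : ℕ, (n : ℂ) * L.coeff n =
      ∑ x ∈ Finset.HasAntidiagonal.antidiagonal n, S x.1 * L.coeff x.2)
    (hS : ∀ n, ‖S n‖ ≤ M * ρ ^ n) (hρ : 0 < ρ) : ‖L.coeff 1‖ ≤ D * ρ := by
  have hL0 : L ≠ 0 := by rintro rfl; simp at hL
  have h0 : L.eval 0 = 1 := by rw [← coeff_zero_eq_eval_zero, hL]
  have h := (IsAlgClosed.splits L).eval_derivative_div_eval_of_ne_zero (x := 0) (by simp [h0])
  rw [h0, div_one, ← coeff_zero_eq_eval_zero, coeff_derivative] at h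
  simp only [zero_add, Nat.cast_zero, mul_one] at h
  rw [h]
  have hb : ∀ w ∈ L.roots.map fun z => 1 / (0 - z), ‖w‖ ≤ ρ := by
    intro w hw
    obtain ⟨z, hz, rfl⟩ := Multiset.mem_map.1 hw
    have h1 := one_le_mul_norm_of_isRoot hL hrec hS hρ ((mem_roots hL0).1 hz)
    have hz0 : 0 < ‖z‖ := by
      by_contra! hle
      nlinarith [norm_nonneg z]
    rw [zero_sub, norm_div, norm_one, norm_neg, div_le_iff₀ hz0]
    exact h1
  calc _ ≤ ((L.roots.map fun z => 1 / (0 - z)).map norm).sum := norm_multiset_sum_le _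
    _ ≤ Multiset.card ((L.roots.map fun z => 1 / (0 - z)).map norm) • ρ :=
      Multiset.sum_le_card_nsmul _ _ fun x hx => by
        obtain ⟨w, hw, rfl⟩ := Multiset.mem_map.1 hx
        exact hb w hw
    _ ≤ D * ρ := by
      rw [Multiset.card_map, Multiset.card_map, nsmul_eq_mul]
      gcongr
      exact (card_roots' L).trans hD

open Classical in
/-- The character `g ↦ e_p(∑_z ∑_w c_w / (z - w))` of polynomials, `z` running over the roots of
`g`, expressed through the logarithmic derivative of `g` at the poles `w ∈ W`. -/
noncomputable def logDerivChar {p : ℕ} [Fact p.Prime] (W : Finset (ZMod p)) (c : ZMod p → ZMod p) :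
    (ZMod p)[X] →* ℂ where
  toFun g := if ∀ w ∈ W, g.eval w ≠ 0 then
    ZMod.stdAddChar (-∑ w ∈ W, c w * (g.derivative.eval w / g.eval w)) else 0
  map_one' := by simp
  map_mul' g h := by
    by_cases hg : ∀ w ∈ W, g.eval w ≠ 0
    · by_cases hh : ∀ w ∈ W, h.eval w ≠ 0
      · have hgh : ∀ w ∈ W, (g * h).eval w ≠ 0 := fun w hw => by
          rw [eval_mul]; exact mul_ne_zero (hg w hw) (hh w hw)
        rw [if_pos hg, if_pos hh, if_pos hgh, ← AddChar.map_add_eq_mul, ← neg_add,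
          ← Finset.sum_add_distrib]
        congr 2
        refine Finset.sum_congr rfl fun w hw => ?_
        have h1 := hg w hw
        have h2 := hh w hw
        rw [derivative_mul, eval_add, eval_mul, eval_mul, eval_mul]
        field_simp
      · rw [if_neg hh, mul_zero, if_neg]
        push Not at hh ⊢
        obtain ⟨w, hw, h0⟩ := hh
        exact ⟨w, hw, by rw [eval_mul, h0, mul_zero]⟩
    · rw [if_neg hg, zero_mul, if_neg]
      push Not at hg ⊢
      obtain ⟨w, hw, h0⟩ := hg
      exact ⟨w, hw, by rw [eval_mul, h0, zero_mul]⟩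

section logDerivChar

variable {p : ℕ} [Fact p.Prime] {W : Finset (ZMod p)} {c : ZMod p → ZMod p}

lemma logDerivChar_of_ne_zero {g : (ZMod p)[X]} (hg : ∀ w ∈ W, g.eval w ≠ 0) :
    logDerivChar W c g = ZMod.stdAddChar (-∑ w ∈ W, c w * (g.derivative.eval w / g.eval w)) :=
  if_pos hg

lemma logDerivChar_of_eq_zero {g : (ZMod p)[X]} {w : ZMod p} (hw : w ∈ W) (hg : g.eval w = 0) :
    logDerivChar W c g = 0 :=
  if_neg fun h => h w hw hg

lemma exists_eval_eq_zero_derivative_eq_single {w₀ : ZMod p} (hw₀ : w₀ ∈ W) :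
    ∃ H : (ZMod p)[X], H.natDegree < 2 * W.card ∧ (∀ w ∈ W, H.eval w = 0) ∧
      H.derivative.eval w₀ = 1 ∧ ∀ w ∈ W, w ≠ w₀ → H.derivative.eval w = 0 := by
  set E : (ZMod p)[X] := ∏ w ∈ W.erase w₀, (X - C w) with hE
  have hE0 : E.eval w₀ ≠ 0 := by
    rw [hE, eval_prod, Finset.prod_ne_zero_iff]
    intro w hw
    simpa [sub_eq_zero] using (Finset.ne_of_mem_erase hw).symm
  have hEw : ∀ w ∈ W, w ≠ w₀ → E.eval w = 0 := by
    intro w hw hne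
    rw [hE, eval_prod]
    exact Finset.prod_eq_zero (Finset.mem_erase.2 ⟨hne, hw⟩) (by simp)
  have hEdeg : E.natDegree = W.card - 1 := by
    rw [hE, natDegree_finsetProd_X_sub_C_eq_card, Finset.card_erase_of_mem hw₀]
  have hcard := Finset.card_pos.2 ⟨w₀, hw₀⟩
  refine ⟨C ((E.eval w₀ ^ 2)⁻¹) * ((X - C w₀) * E ^ 2), ?_, ?_, ?_, ?_⟩
  · refine lt_of_le_of_lt ((natDegree_C_mul_le _ _).trans natDegree_mul_le) ?_
    rw [natDegree_X_sub_C, natDegree_pow, hEdeg]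
    omega
  · intro w hw
    by_cases h : w = w₀
    · simp [h]
    · simp [hEw w hw h]
  · simp [derivative_mul, hE0]
  · intro w hw h
    simp [derivative_mul, derivative_pow, hEw w hw h]

lemma sum_logDerivChar_eq_zero {w₀ : ZMod p} (hw₀ : w₀ ∈ W) (hc : c w₀ ≠ 0) {n : ℕ}
    (hn : 2 * W.card ≤ n) : ∑ g ∈ monicsOfDegree (ZMod p) n, logDerivChar W c g = 0 := by
  have hp : p.Prime := Fact.out
  obtain ⟨H, hdeg, hH, hH1, hH2⟩ := exists_eval_eq_zero_derivative_eq_single hw₀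
  have hlt : ∀ (t : ZMod p) (g : (ZMod p)[X]), g ∈ monicsOfDegree (ZMod p) n →
      (C t * H).degree < g.degree := by
    intro t g hg
    obtain ⟨h1, h2⟩ := mem_monicsOfDegree.1 hg
    rw [degree_eq_natDegree h1.ne_zero, h2]
    refine lt_of_le_of_lt degree_le_natDegree ?_
    exact_mod_cast (natDegree_C_mul_le t H).trans_lt (hdeg.trans_le hn)
  have hmem : ∀ (t : ZMod p) (g : (ZMod p)[X]), g ∈ monicsOfDegree (ZMod p) n →
      g + C t * H ∈ monicsOfDegree (ZMod p) n := by
    intro t g hg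
    obtain ⟨h1, h2⟩ := mem_monicsOfDegree.1 hg
    refine mem_monicsOfDegree.2 ⟨h1.add_of_left (hlt t g hg), ?_⟩
    rw [natDegree_add_eq_left_of_degree_lt (hlt t g hg), h2]
  have htrans : ∀ t : ZMod p, ∑ g ∈ monicsOfDegree (ZMod p) n, logDerivChar W c (g + C t * H) =
      ∑ g ∈ monicsOfDegree (ZMod p) n, logDerivChar W c g := by
    intro t
    refine Finset.sum_nbij' (fun g => g + C t * H) (fun g => g + C (-t) * H) (fun g => hmem t g)
      (fun g => hmem (-t) g) (fun g _ => ?_) (fun g _ => ?_) fun g _ => rfl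
    · simp
    · simp
  have hzero : ∀ g ∈ monicsOfDegree (ZMod p) n,
      ∑ t : ZMod p, logDerivChar W c (g + C t * H) = 0 := by
    intro g _
    have hev : ∀ t, ∀ w ∈ W, (g + C t * H).eval w = g.eval w := by
      intro t w hw
      simp [hH w hw]
    by_cases hg : ∀ w ∈ W, g.eval w ≠ 0
    · have h1 : ∀ t : ZMod p, logDerivChar W c (g + C t * H) = logDerivChar W c g *
          ZMod.stdAddChar (-(c w₀ / g.eval w₀) * t) := by
        intro t
        rw [logDerivChar_of_ne_zero hg, logDerivChar_of_ne_zero fun w hw => by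
          rw [hev t w hw]; exact hg w hw, ← AddChar.map_add_eq_mul]
        congr 1
        rw [neg_mul, ← neg_add, ← Finset.add_sum_erase _ _ hw₀, ← Finset.add_sum_erase _ _ hw₀,
          add_right_comm]
        congr 2
        · rw [hev t _ hw₀]
          simp [hH1]
          ring
        · refine Finset.sum_congr rfl fun w hw => ?_
          obtain ⟨hne, hw⟩ := Finset.mem_erase.1 hw
          rw [hev t _ hw]
          simp [hH2 w hw hne]
      simp only [h1]
      rw [← Finset.mul_sum]
      refine mul_eq_zero_of_right _ ?_
      have hne : -(c w₀ / g.eval w₀) ≠ 0 := neg_ne_zero.2 (div_ne_zero hc (hg w₀ hw₀))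
      have h2 := AddChar.sum_mulShift (R := ZMod p) (-(c w₀ / g.eval w₀))
        (ZMod.isPrimitive_stdAddChar p)
      rw [if_neg hne] at h2
      rw [← Nat.cast_zero, ← h2]
      exact Finset.sum_congr rfl fun t _ => by rw [mul_comm]
    · push Not at hg
      obtain ⟨w, hw, h0⟩ := hg
      exact Finset.sum_eq_zero fun t _ => logDerivChar_of_eq_zero hw (by rw [hev t w hw, h0])
  have h3 : (p : ℂ) * ∑ g ∈ monicsOfDegree (ZMod p) n, logDerivChar W c g = 0 := by
    calc (p : ℂ) * ∑ g ∈ monicsOfDegree (ZMod p) n, logDerivChar W c g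
        = ∑ t : ZMod p, ∑ g ∈ monicsOfDegree (ZMod p) n, logDerivChar W c (g + C t * H) := by
          simp [htrans, ZMod.card]
      _ = 0 := by
          rw [Finset.sum_comm]
          exact Finset.sum_eq_zero hzero
  exact (mul_eq_zero.1 h3).resolve_left (by exact_mod_cast hp.ne_zero)

end logDerivChar

open IntermediateField in
lemma trace_inv_gen_sub_algebraMap {F L : Type*} [Field F] [Field L] [Algebra F L]
    [FiniteDimensional F L] [Algebra.IsSeparable F L] (pb : PowerBasis F L) {w : F}
    (hw : (minpoly F pb.gen).eval w ≠ 0) :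
    Algebra.trace F L (pb.gen - algebraMap F L w)⁻¹ =
      -((minpoly F pb.gen).derivative.eval w / (minpoly F pb.gen).eval w) := by
  classical
  let E := AlgebraicClosure L
  apply (algebraMap F E).injective
  set P := minpoly F pb.gen with hP
  have hPw : (P.map (algebraMap F E)).eval (algebraMap F E w) ≠ 0 := by
    rw [eval_map_algebraMap, aeval_algebraMap_apply, ← coe_aeval_eq_eval] at *
    exact fun h => hw ((algebraMap F E).injective (by rw [map_zero]; exact h))
  have h1 := (IsAlgClosed.splits (P.map (algebraMap F E))).eval_derivative_div_eval_of_ne_zero hPw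
  have h2 : (P.map (algebraMap F E)).roots.Nodup :=
    nodup_roots (Polynomial.Separable.map (Algebra.IsSeparable.isSeparable F pb.gen))
  rw [derivative_map, eval_map_algebraMap, eval_map_algebraMap, aeval_algebraMap_apply,
    aeval_algebraMap_apply] at h1
  rw [map_neg, map_div₀, ← coe_aeval_eq_eval]
  refine Eq.trans ?_ (congrArg Neg.neg h1.symm)
  rw [trace_eq_sum_embeddings E, Fintype.sum_equiv pb.liftEquiv' _
    (fun y => ((y : E) - algebraMap F E w)⁻¹) (fun σ => by
      rw [PowerBasis.liftEquiv'_apply_coe, map_inv₀, map_sub, AlgHom.commutes])]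
  rw [Finset.sum_mem_multiset (P.aroots E) _ (fun y => (y - algebraMap F E w)⁻¹) (fun y => rfl),
    Finset.sum_eq_multiset_sum, Multiset.toFinset_val, Multiset.dedup_eq_self.mpr h2,
    ← Multiset.sum_map_neg', Multiset.map_map]
  refine congrArg Multiset.sum (Multiset.map_congr rfl fun y _ => ?_)
  rw [Function.comp_apply, one_div, ← inv_neg, neg_sub]

open IntermediateField in
lemma trace_inv_sub_algebraMap {F K : Type*} [Field F] [Field K] [Algebra F K]
    [FiniteDimensional F K] [Algebra.IsSeparable F K] (x : K) {w : F}
    (hw : (minpoly F x).eval w ≠ 0) :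
    Algebra.trace F K (x - algebraMap F K w)⁻¹ = Module.finrank F⟮x⟯ K •
      -((minpoly F x).derivative.eval w / (minpoly F x).eval w) := by
  have hx : IsIntegral F x := Algebra.IsIntegral.isIntegral x
  have : Algebra.IsSeparable F F⟮x⟯ := Algebra.isSeparable_tower_bot_of_isSeparable F F⟮x⟯ K
  have hgen : minpoly F (adjoin.powerBasis hx).gen = minpoly F x := by
    rw [adjoin.powerBasis_gen, minpoly_gen]
  have h := trace_inv_gen_sub_algebraMap (adjoin.powerBasis hx) (w := w) (by rwa [hgen])
  rw [hgen] at h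
  rw [← h, ← Algebra.trace_trace (S := F⟮x⟯), adjoin.powerBasis_gen]
  have : (x - algebraMap F K w)⁻¹ =
      algebraMap F⟮x⟯ K (AdjoinSimple.gen F x - algebraMap F F⟮x⟯ w)⁻¹ := by
    rw [map_inv₀, map_sub, AdjoinSimple.algebraMap_gen, ← IsScalarTower.algebraMap_apply]
  rw [this, Algebra.trace_algebraMap, map_nsmul]

lemma eval_minpoly_eq_zero_iff {F K : Type*} [Field F] [Field K] [Algebra F K]
    [FiniteDimensional F K] (x : K) (w : F) :
    (minpoly F x).eval w = 0 ↔ x = algebraMap F K w := by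
  have hx : IsIntegral F x := Algebra.IsIntegral.isIntegral x
  constructor
  · intro h
    have h1 := (irreducible_X_sub_C w).associated_of_dvd (minpoly.irreducible hx)
      (dvd_iff_isRoot.2 h)
    have h2 := eq_of_monic_of_associated (monic_X_sub_C w) (minpoly.monic hx) h1
    have h3 := minpoly.aeval F x
    rw [← h2, map_sub, aeval_X, aeval_C] at h3
    exact sub_eq_zero.1 h3
  · rintro rfl
    simp [minpoly.eq_X_sub_C]

open Classical in
/-- The summand of a complete exponential sum with poles at `W` over an extension of `𝔽_p`. -/
noncomputable def polarTerm {p : ℕ} [Fact p.Prime] (W : Finset (ZMod p)) (c : ZMod p → ZMod p)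
    {K : Type*} [Field K] [Algebra (ZMod p) K] (x : K) : ℂ :=
  if ∀ w ∈ W, x ≠ algebraMap (ZMod p) K w then
    ZMod.stdAddChar (Algebra.trace (ZMod p) K
      (∑ w ∈ W, algebraMap (ZMod p) K (c w) * (x - algebraMap (ZMod p) K w)⁻¹)) else 0

open IntermediateField in
lemma logDerivChar_minpoly_pow {p : ℕ} [Fact p.Prime] (W : Finset (ZMod p)) (c : ZMod p → ZMod p)
    {K : Type*} [Field K] [Finite K] [Algebra (ZMod p) K] (x : K) :
    logDerivChar W c (minpoly (ZMod p) x) ^ Module.finrank (ZMod p)⟮x⟯ K = polarTerm W c x := by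
  by_cases h : ∀ w ∈ W, x ≠ algebraMap (ZMod p) K w
  · have h' : ∀ w ∈ W, (minpoly (ZMod p) x).eval w ≠ 0 := fun w hw h0 =>
      h w hw ((eval_minpoly_eq_zero_iff x w).1 h0)
    rw [polarTerm, if_pos h, logDerivChar_of_ne_zero h', ← AddChar.map_nsmul_eq_pow]
    congr 1
    rw [map_sum, ← Finset.sum_neg_distrib, Finset.smul_sum]
    refine Finset.sum_congr rfl fun w hw => ?_
    rw [← Algebra.smul_def, map_smul, trace_inv_sub_algebraMap x (h' w hw), smul_eq_mul,
      mul_smul_comm, neg_mul_eq_mul_neg]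
  · rw [polarTerm, if_neg h]
    push Not at h
    obtain ⟨w, hw, h0⟩ := h
    rw [logDerivChar_of_eq_zero hw ((eval_minpoly_eq_zero_iff x w).2 h0), zero_pow]
    exact (Module.finrank_pos).ne'

open Classical in
lemma card_minpoly_eq {p m : ℕ} [Fact p.Prime] {K : Type*} [Field K] [Fintype K]
    [Algebra (ZMod p) K] (hK : Module.finrank (ZMod p) K = m) {d : ℕ} (hd : d ∣ m)
    {P : (ZMod p)[X]} (hP : P ∈ irreduciblesOfDegree (ZMod p) d) :
    (Finset.univ.filter fun x : K => minpoly (ZMod p) x = P).card = d := by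
  obtain ⟨⟨hP1, rfl⟩, hP2⟩ := mem_irreduciblesOfDegree.1 hP
  have hcard : Fintype.card K = p ^ m := by
    rw [← hK, Module.card_eq_pow_finrank (K := ZMod p), ZMod.card]
  have hdvd := (hP2.natDegree_dvd_iff_dvd_X_pow_card_pow_sub_X).1 hd
  rw [Nat.card_zmod, ← hcard] at hdvd
  have hne : (X ^ Fintype.card K - X : K[X]) ≠ 0 :=
    FiniteField.X_pow_card_sub_X_ne_zero K Fintype.one_lt_card
  have hsplit : Splits (P.map (algebraMap (ZMod p) K)) := by
    refine Splits.of_dvd (FiniteField.splits_X_pow_card_sub_X (K := K) p) ?_ ?_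
    · exact (Polynomial.map_ne_zero_iff (algebraMap (ZMod p) K).injective).2
        (FiniteField.X_pow_card_sub_X_ne_zero (ZMod p) Fintype.one_lt_card)
    · exact Polynomial.map_dvd _ hdvd
  rw [← card_rootSet_eq_natDegree (PerfectField.separable_of_irreducible hP2) hsplit,
    ← Set.toFinset_card]
  congr 1
  ext x
  simp only [Finset.mem_filter, Finset.mem_univ, true_and, Set.mem_toFinset, mem_rootSet]
  constructor
  · rintro rfl
    exact ⟨hP1.ne_zero, minpoly.aeval _ _⟩
  · rintro ⟨_, h⟩
    exact (minpoly.eq_of_irreducible_of_monic hP2 h hP1).symm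

open IntermediateField in
lemma primePowerSum_eq_sum {p m : ℕ} [Fact p.Prime] (lam : (ZMod p)[X] →* ℂ) {K : Type*} [Field K]
    [Fintype K] [Algebra (ZMod p) K] (hK : Module.finrank (ZMod p) K = m) :
    primePowerSum lam m =
      ∑ x : K, lam (minpoly (ZMod p) x) ^ Module.finrank (ZMod p)⟮x⟯ K := by
  classical
  have hm : 0 < m := by rw [← hK]; exact Module.finrank_pos
  have hmul : ∀ x : K, (minpoly (ZMod p) x).natDegree * Module.finrank (ZMod p)⟮x⟯ K = m := by
    intro x
    rw [← hK, ← adjoin.finrank (Algebra.IsIntegral.isIntegral x), Module.finrank_mul_finrank]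
  let φ : K → (_ : ℕ × ℕ) × (ZMod p)[X] := fun x =>
    ⟨((minpoly (ZMod p) x).natDegree, Module.finrank (ZMod p)⟮x⟯ K), minpoly (ZMod p) x⟩
  rw [primePowerSum, Finset.sum_sigma', ← Finset.sum_fiberwise_of_maps_to (g := φ)
    (t := m.divisorsAntidiagonal.sigma fun x => irreduciblesOfDegree (ZMod p) x.1)]
  · refine Finset.sum_congr rfl ?_
    rintro ⟨⟨d, j⟩, P⟩ h
    obtain ⟨h1, hP⟩ := Finset.mem_sigma.1 h
    obtain ⟨hdj, -⟩ := Nat.mem_divisorsAntidiagonal.1 h1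
    have hset : (Finset.univ.filter fun x : K => φ x = ⟨(d, j), P⟩) =
        Finset.univ.filter fun x : K => minpoly (ZMod p) x = P := by
      ext x
      simp only [Finset.mem_filter, Finset.mem_univ, true_and]
      constructor
      · intro h
        exact congrArg (fun y : (_ : ℕ × ℕ) × (ZMod p)[X] => y.2) h
      · rintro rfl
        have hd : (minpoly (ZMod p) x).natDegree = d := (mem_irreduciblesOfDegree.1 hP).1.2
        have hj : Module.finrank (ZMod p)⟮x⟯ K = j := by
          refine Nat.eq_of_mul_eq_mul_left (minpoly.natDegree_pos
            (Algebra.IsIntegral.isIntegral (R := ZMod p) x)) ?_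
          rw [hmul, hd, ← hdj]
        simp only [φ, hd, hj]
    rw [Finset.sum_congr rfl (g := fun _ => lam P ^ j), Finset.sum_const, hset,
      card_minpoly_eq hK ⟨j, hdj.symm⟩ hP, nsmul_eq_mul]
    intro x hx
    have h := (Finset.mem_filter.1 hx).2
    simp only [φ, Sigma.mk.injEq, Prod.mk.injEq, heq_eq_eq] at h
    rw [h.1.2, h.2]
  · intro x _
    have hx_int : IsIntegral (ZMod p) x := Algebra.IsIntegral.isIntegral x
    exact Finset.mem_sigma.2 ⟨Nat.mem_divisorsAntidiagonal.2 ⟨hmul x, hm.ne'⟩,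
      mem_irreduciblesOfDegree.2 ⟨⟨minpoly.monic hx_int, rfl⟩, minpoly.irreducible hx_int⟩⟩

section polarTerm

variable {p : ℕ} [Fact p.Prime] {W : Finset (ZMod p)} {c : ZMod p → ZMod p}
  {K : Type*} [Field K] [Algebra (ZMod p) K]

lemma norm_polarTerm_le_one (x : K) : ‖polarTerm W c x‖ ≤ 1 := by
  rw [polarTerm]
  split_ifs
  · rw [AddChar.norm_apply]
  · simp

lemma norm_sum_polarTerm_le_card [Fintype K] : ‖∑ x : K, polarTerm W c x‖ ≤ Fintype.card K := by
  refine (norm_sum_le_of_le _ fun x _ => norm_polarTerm_le_one x).trans ?_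
  simp

lemma sum_stdAddChar_eq_zero : ∑ a : ZMod p, ZMod.stdAddChar (N := p) a = 0 := by
  refine AddChar.sum_eq_zero_of_ne_one fun h => ?_
  have h1 : ZMod.stdAddChar (N := p) 1 = ZMod.stdAddChar (N := p) 0 := by
    rw [h, AddChar.one_apply, AddChar.one_apply]
  exact one_ne_zero (ZMod.injective_stdAddChar h1)

open Classical in
lemma card_trace_polar_eq_le [Fintype K] {w₀ : ZMod p} (hw₀ : w₀ ∈ W) (hc : c w₀ ≠ 0)
    {μ ν : ℕ} (hμν : μ ≤ ν) (hr : W.card + 3 ≤ p ^ (μ + 1))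
    (hK : Module.finrank (ZMod p) K = μ + ν + 2) (a : ZMod p) :
    (Finset.univ.filter fun x : K => (∀ w ∈ W, x ≠ algebraMap (ZMod p) K w) ∧
      Algebra.trace (ZMod p) K
        (∑ w ∈ W, algebraMap (ZMod p) K (c w) * (x - algebraMap (ZMod p) K w)⁻¹) = a).card ≤
      p ^ (μ + ν + 1) + (2 * W.card + 3) * p ^ (ν + 1) := by
  set Q : (ZMod p)[X] := ∏ w ∈ W, (X - C w) with hQ
  set P : (ZMod p)[X] := ∑ w ∈ W, C (c w) * ∏ w' ∈ W.erase w, (X - C w') with hP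
  have hcard : Fintype.card K = p ^ (μ + ν + 2) := by
    rw [← hK, Module.card_eq_pow_finrank (K := ZMod p), ZMod.card]
  have hQ' : Q = (X - C w₀) * ∏ w ∈ W.erase w₀, (X - C w) := (Finset.mul_prod_erase _ _ hw₀).symm
  have hQ₁ : (∏ w ∈ W.erase w₀, (X - C w)).eval w₀ ≠ 0 := by
    rw [eval_prod, Finset.prod_ne_zero_iff]
    intro w hw
    simpa [sub_eq_zero] using (Finset.ne_of_mem_erase hw).symm
  have hP0 : P.eval w₀ ≠ 0 := by
    rw [hP, eval_finsetSum, Finset.sum_eq_single_of_mem w₀ hw₀, eval_mul, eval_C]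
    · exact mul_ne_zero hc hQ₁
    · intro w hw hne
      rw [eval_mul, eval_prod,
        Finset.prod_eq_zero (Finset.mem_erase.2 ⟨hne.symm, hw₀⟩) (by simp), mul_zero]
  have hPr : P.natDegree ≤ W.card := by
    refine natDegree_sum_le_of_forall_le _ _ fun w hw => (natDegree_C_mul_le _ _).trans ?_
    rw [natDegree_finsetProd_X_sub_C_eq_card]
    exact Finset.card_le_card (Finset.erase_subset _ _)
  have hQr : Q.natDegree ≤ W.card := (natDegree_finsetProd_X_sub_C_eq_card _ _).le
  refine le_trans (Finset.card_le_card ?_)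
    (card_trace_eq_le hQ' hQ₁ hP0 hPr hQr hμν hr hcard a)
  intro x hx
  rw [Finset.mem_filter] at hx ⊢
  obtain ⟨-, hx1, hx2⟩ := hx
  have hne : ∀ w ∈ W, x - algebraMap (ZMod p) K w ≠ 0 := fun w hw => sub_ne_zero.2 (hx1 w hw)
  have hQx : aeval x Q = ∏ w ∈ W, (x - algebraMap (ZMod p) K w) := by simp [hQ]
  have hQx0 : aeval x Q ≠ 0 := by
    rw [hQx]
    exact Finset.prod_ne_zero_iff.2 hne
  have hdiv : aeval x P / aeval x Q =
      ∑ w ∈ W, algebraMap (ZMod p) K (c w) * (x - algebraMap (ZMod p) K w)⁻¹ := by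
    rw [div_eq_iff hQx0, hP, map_sum, Finset.sum_mul]
    refine Finset.sum_congr rfl fun w hw => ?_
    rw [hQx, ← Finset.mul_prod_erase _ _ hw, mul_assoc, inv_mul_cancel_left₀ (hne w hw)]
    simp
  refine ⟨Finset.mem_univ _, hQx0, ?_⟩
  rw [hdiv, ← hx2, FiniteField.algebraMap_trace_eq_sum_pow, hK, Nat.card_zmod]

lemma norm_sum_polarTerm_le [Fintype K] {w₀ : ZMod p} (hw₀ : w₀ ∈ W) (hc : c w₀ ≠ 0)
    {μ ν : ℕ} (hμν : μ ≤ ν) (hr : W.card + 3 ≤ p ^ (μ + 1))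
    (hK : Module.finrank (ZMod p) K = μ + ν + 2) :
    ‖∑ x : K, polarTerm W c x‖ ≤ p * ((2 * W.card + 3) * p ^ (ν + 1)) + W.card := by
  classical
  set good : K → Prop := fun x => ∀ w ∈ W, x ≠ algebraMap (ZMod p) K w with hgood
  set f : K → ZMod p := fun x => Algebra.trace (ZMod p) K
    (∑ w ∈ W, algebraMap (ZMod p) K (c w) * (x - algebraMap (ZMod p) K w)⁻¹) with hf
  set T : ZMod p → ℕ := fun a => (Finset.univ.filter fun x : K => good x ∧ f x = a).card with hT
  set E : ℝ := (2 * W.card + 3) * p ^ (ν + 1) with hE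
  have hT_le : ∀ a, (T a : ℝ) ≤ p ^ (μ + ν + 1) + E := fun a => by
    have := card_trace_polar_eq_le hw₀ hc hμν hr hK a
    rw [hE]
    exact_mod_cast this
  have hcard : Fintype.card K = p ^ (μ + ν + 2) := by
    rw [← hK, Module.card_eq_pow_finrank (K := ZMod p), ZMod.card]
  have hTsum : ∑ a, T a = (Finset.univ.filter good).card := by
    rw [Finset.card_eq_sum_card_fiberwise (f := f) (t := Finset.univ) (by simp)]
    refine Finset.sum_congr rfl fun a _ => ?_
    rw [Finset.filter_filter]
  have hTsum_ge : p ^ (μ + ν + 2) ≤ ∑ a, T a + W.card := by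
    rw [hTsum, ← hcard, ← Finset.card_univ,
      ← Finset.card_filter_add_card_filter_not (s := Finset.univ) good]
    refine Nat.add_le_add_left ?_ _
    refine (Finset.card_le_card (t := W.image (algebraMap (ZMod p) K)) ?_).trans
      Finset.card_image_le
    intro x hx
    have hx' := (Finset.mem_filter.1 hx).2
    simp only [hgood, not_forall, not_not] at hx'
    obtain ⟨w, hw, h⟩ := hx'
    exact Finset.mem_image.2 ⟨w, hw, h.symm⟩
  have hS : ∑ x : K, polarTerm W c x = ∑ a, (T a : ℂ) * ZMod.stdAddChar a := by
    rw [← Finset.sum_fiberwise (g := f)]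
    refine Finset.sum_congr rfl fun a _ => ?_
    have hset : (Finset.univ.filter fun x : K => good x ∧ f x = a) =
        (Finset.univ.filter fun x : K => f x = a).filter good := by
      ext x
      simp [and_comm]
    rw [hT, ← nsmul_eq_mul, ← Finset.sum_const, hset,
      Finset.sum_filter (p := good)]
    refine Finset.sum_congr rfl fun x hx => ?_
    rw [← (Finset.mem_filter.1 hx).2]
    rfl
  have hS' : ∑ x : K, polarTerm W c x =
      -∑ a, (((p : ℝ) ^ (μ + ν + 1) + E - T a : ℝ) : ℂ) * ZMod.stdAddChar a := by
    push_cast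
    simp_rw [sub_mul]
    rw [Finset.sum_sub_distrib, ← Finset.mul_sum, sum_stdAddChar_eq_zero, hS, mul_zero, zero_sub,
      neg_neg]
  rw [hS', norm_neg]
  refine (norm_sum_le_of_le (n := fun a => (p : ℝ) ^ (μ + ν + 1) + E - T a) _
    fun a _ => ?_).trans ?_
  · rw [norm_mul, AddChar.norm_apply, mul_one, Complex.norm_real, Real.norm_of_nonneg]
    exact sub_nonneg.2 (hT_le a)
  · rw [Finset.sum_sub_distrib, Finset.sum_const, Finset.card_univ, ZMod.card, nsmul_eq_mul]
    have h : (p : ℝ) ^ (μ + ν + 2) ≤ ∑ a, (T a : ℝ) + W.card := by exact_mod_cast hTsum_ge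
    have h2 : (p : ℝ) * (p ^ (μ + ν + 1) + E) = p ^ (μ + ν + 2) + p * E := by ring
    linarith

end polarTerm

lemma exists_norm_primePowerSum_logDerivChar_le {p : ℕ} [Fact p.Prime] {W : Finset (ZMod p)}
    {c : ZMod p → ZMod p} {w₀ : ZMod p} (hw₀ : w₀ ∈ W) (hc : c w₀ ≠ 0) :
    ∃ M : ℝ, ∀ n : ℕ, ‖primePowerSum (logDerivChar W c) n‖ ≤ M * √p ^ n := by
  have hp := (Fact.out : p.Prime)
  set r := W.card with hr
  have hp1 : (1 : ℝ) ≤ p := by exact_mod_cast hp.one_lt.le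
  have hs1 : (1 : ℝ) ≤ √p := Real.one_le_sqrt.2 hp1
  refine ⟨p ^ (2 * r + 8) + p * ((2 * r + 3) * √p) + r, fun n => ?_⟩
  have hpow1 : (1 : ℝ) ≤ √p ^ n := one_le_pow₀ hs1
  rcases Nat.eq_zero_or_pos n with rfl | hn
  · simp only [primePowerSum, Nat.divisorsAntidiagonal_zero, Finset.sum_empty, norm_zero]
    positivity
  have : Fintype (GaloisField p n) := Fintype.ofFinite _
  have hfr := GaloisField.finrank p hn.ne'
  have hcard : Fintype.card (GaloisField p n) = p ^ n := by
    rw [← Nat.card_eq_fintype_card, GaloisField.card p n hn.ne']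
  rw [primePowerSum_eq_sum (logDerivChar W c) hfr,
    Finset.sum_congr rfl fun x _ => logDerivChar_minpoly_pow W c x]
  rcases lt_or_ge n (2 * r + 8) with hlt | hge
  · refine norm_sum_polarTerm_le_card.trans ?_
    rw [hcard, Nat.cast_pow]
    have h1 : (p : ℝ) ^ n ≤ p ^ (2 * r + 8) := pow_le_pow_right₀ hp1 hlt.le
    have h2 : (0 : ℝ) ≤ p * ((2 * r + 3) * √p) + r := by positivity
    exact (by linarith : (p : ℝ) ^ n ≤ p ^ (2 * r + 8) + p * ((2 * r + 3) * √p) + r).trans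
      (le_mul_of_one_le_right (by positivity) hpow1)
  · obtain ⟨μ, ν, hμν, hνμ, rfl, hrμ⟩ :
        ∃ μ ν, μ ≤ ν ∧ ν ≤ μ + 1 ∧ n = μ + ν + 2 ∧ r + 3 ≤ μ + 1 :=
      ⟨(n - 2) / 2, n - 2 - (n - 2) / 2, by omega, by omega, by omega, by omega⟩
    have hrp : r + 3 ≤ p ^ (μ + 1) := hrμ.trans (Nat.lt_pow_self hp.one_lt).le
    refine (norm_sum_polarTerm_le hw₀ hc hμν hrp hfr).trans ?_
    have h1 : (p : ℝ) ^ (ν + 1) ≤ √p * √p ^ (μ + ν + 2) := by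
      calc (p : ℝ) ^ (ν + 1) = √p ^ (2 * (ν + 1)) := by
            rw [pow_mul, Real.sq_sqrt (by positivity)]
        _ ≤ √p ^ (μ + ν + 3) := pow_le_pow_right₀ hs1 (by omega)
        _ = √p * √p ^ (μ + ν + 2) := by ring
    calc (p : ℝ) * ((2 * r + 3) * p ^ (ν + 1)) + r
        ≤ p * ((2 * r + 3) * (√p * √p ^ (μ + ν + 2))) + r * √p ^ (μ + ν + 2) := by
          gcongr
          exact le_mul_of_one_le_right (by positivity) hpow1
      _ = (p * ((2 * r + 3) * √p) + r) * √p ^ (μ + ν + 2) := by ring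
      _ ≤ _ := by
          gcongr
          have : (0 : ℝ) ≤ p ^ (2 * r + 8) := by positivity
          linarith

lemma monicsOfDegree_zero (F : Type*) [Field F] [Finite F] : monicsOfDegree F 0 = {1} := by
  ext g
  rw [mem_monicsOfDegree, Finset.mem_singleton]
  exact ⟨fun h => h.1.natDegree_eq_zero.1 h.2, fun h => h ▸ ⟨monic_one, natDegree_one⟩⟩

lemma sum_monicsOfDegree_one {F : Type*} [Field F] [Fintype F] (f : F[X] → ℂ) :
    ∑ g ∈ monicsOfDegree F 1, f g = ∑ u : F, f (X - C u) := by
  symm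
  refine Finset.sum_bij (fun u _ => X - C u) (fun u _ => ?_) (fun u _ v _ h => ?_) (fun g hg => ?_)
    (fun _ _ => rfl)
  · exact mem_monicsOfDegree.2 ⟨monic_X_sub_C u, natDegree_X_sub_C u⟩
  · simpa using h
  · obtain ⟨h1, h2⟩ := mem_monicsOfDegree.1 hg
    refine ⟨-g.coeff 0, Finset.mem_univ _, ?_⟩
    rw [h1.eq_X_add_C h2]
    simp

open Classical in
/-- Weil's bound for the exponential sum of a rational function with simple poles. -/
theorem norm_sum_stdAddChar_simple_poles_le {p : ℕ} [Fact p.Prime] {W : Finset (ZMod p)}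
    {c : ZMod p → ZMod p} {w₀ : ZMod p} (hw₀ : w₀ ∈ W) (hc : c w₀ ≠ 0) :
    ‖∑ u : ZMod p, if ∀ w ∈ W, u ≠ w then
      ZMod.stdAddChar (∑ w ∈ W, c w * (u - w)⁻¹) else (0 : ℂ)‖ ≤ 2 * W.card * √p := by
  set lam := logDerivChar W c with hlam
  set r := W.card with hr
  have hr0 : 0 < r := Finset.card_pos.2 ⟨w₀, hw₀⟩
  obtain ⟨M, hM⟩ := exists_norm_primePowerSum_logDerivChar_le hw₀ hc
  set L : ℂ[X] := ∑ n ∈ Finset.range (2 * r),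
    C (∑ g ∈ monicsOfDegree (ZMod p) n, lam g) * X ^ n with hL
  have hcoeff : ∀ n, L.coeff n = ∑ g ∈ monicsOfDegree (ZMod p) n, lam g := by
    intro n
    simp only [hL, finsetSum_coeff, coeff_C_mul_X_pow]
    rw [Finset.sum_ite_eq]
    split_ifs with h
    · rfl
    · rw [Finset.mem_range, not_lt] at h
      exact (sum_logDerivChar_eq_zero hw₀ hc h).symm
  have h := norm_coeff_one_le (L := L) (S := primePowerSum lam) (D := 2 * r) (ρ := √p) (M := M)
    (by rw [hcoeff, monicsOfDegree_zero, Finset.sum_singleton, map_one])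
    (by
      refine natDegree_sum_le_of_forall_le _ _ fun n hn => (natDegree_C_mul_X_pow_le _ _).trans ?_
      exact (Finset.mem_range.1 hn).le)
    (fun n => by
      simp only [hcoeff]
      exact natCast_mul_sum_monics lam n)
    hM (Real.sqrt_pos.2 (by exact_mod_cast (Fact.out : p.Prime).pos))
  rw [hcoeff, sum_monicsOfDegree_one] at h
  push_cast at h
  convert h using 3 with u
  have hX : ∀ w, (X - C u : (ZMod p)[X]).eval w = w - u := by simp
  split_ifs with hu
  · have hne : ∀ w ∈ W, (X - C u : (ZMod p)[X]).eval w ≠ 0 := fun w hw => by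
      rw [hX, sub_ne_zero]
      exact (hu w hw).symm
    rw [hlam, logDerivChar_of_ne_zero hne, ← Finset.sum_neg_distrib]
    congr 1
    refine Finset.sum_congr rfl fun w hw => ?_
    rw [hX, derivative_X_sub_C, eval_one, one_div, ← mul_neg, ← inv_neg, neg_sub]
  · push Not at hu
    obtain ⟨w, hw, rfl⟩ := hu
    rw [hlam, logDerivChar_of_eq_zero hw (by rw [hX, sub_self])]

section psi

open scoped ComplexConjugate

variable {p : ℕ} [Fact p.Prime]

lemma psi_zero (x y : ZMod p) : psi p x y 0 = 0 := if_pos rfl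

lemma psi_of_ne_zero (x y : ZMod p) {u : ZMod p} (hu : u ≠ 0) :
    psi p x y u = ZMod.stdAddChar (x * u + y * u⁻¹) := by
  rw [psi, if_neg hu, ZMod.stdAddChar_apply, ZMod.toCircle_apply]

lemma norm_psi_le_one (x y u : ZMod p) : ‖psi p x y u‖ ≤ 1 := by
  by_cases hu : u = 0
  · rw [hu, psi_zero]
    simp
  · rw [psi_of_ne_zero x y hu, AddChar.norm_apply]

lemma norm_prod_psi_le_one {k : ℕ} (x y u : ZMod p) (s : Fin k → ZMod p) :
    ‖∏ i, psi p x y (u + s i)‖ ≤ 1 := by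
  rw [norm_prod]
  exact Finset.prod_le_one (fun _ _ => norm_nonneg _) fun _ _ => norm_psi_le_one _ _ _

lemma prod_psi_of_ne_zero {k : ℕ} (x y u : ZMod p) {s : Fin k → ZMod p}
    (hs : ∀ i, u + s i ≠ 0) :
    ∏ i, psi p x y (u + s i) =
      ZMod.stdAddChar (∑ i, (x * (u + s i) + y * (u + s i)⁻¹)) := by
  rw [Finset.prod_congr rfl fun i _ => psi_of_ne_zero x y (hs i)]
  exact (map_prod (ZMod.stdAddChar (N := p)).toMonoidHom
    (fun i => Multiplicative.ofAdd (x * (u + s i) + y * (u + s i)⁻¹)) Finset.univ).symm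

/-- The correlation of shifts of `psi` along two tuples. -/
noncomputable def psiCorrelation {k : ℕ} (x y : ZMod p) (s t : Fin k → ZMod p) : ℂ :=
  ∑ u : ZMod p, (∏ i, psi p x y (u + s i)) * conj (∏ i, psi p x y (u + t i))

lemma norm_psiCorrelation_le {k : ℕ} (x y : ZMod p) (s t : Fin k → ZMod p) :
    ‖psiCorrelation x y s t‖ ≤ p := by
  refine (norm_sum_le_of_le (n := fun _ => 1) _ fun u _ => ?_).trans (by simp [ZMod.card])
  rw [norm_mul, RCLike.norm_conj]
  exact mul_le_one₀ (norm_prod_psi_le_one _ _ _ _) (norm_nonneg _) (norm_prod_psi_le_one _ _ _ _)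

open Classical in
lemma exists_perm_of_card_fiber_eq {k : ℕ} {α : Type*} {s t : Fin k → α}
    (h : ∀ z, (Finset.univ.filter fun i => s i = z).card =
      (Finset.univ.filter fun i => t i = z).card) :
    ∃ σ : Equiv.Perm (Fin k), t = s ∘ σ := by
  have e : ∀ z, Nonempty ({i // t i = z} ≃ {i // s i = z}) := fun z => by
    refine Fintype.card_eq.1 ?_
    rw [Fintype.card_subtype, Fintype.card_subtype, h z]
  refine ⟨Equiv.ofFiberEquiv fun z => (e z).some, funext fun i => ?_⟩
  exact (Equiv.ofFiberEquiv_map _ i).symm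

open Classical in
lemma norm_psiCorrelation_le_sqrt {k : ℕ} (hkp : k < p) {x y : ZMod p} (hy : y ≠ 0)
    {s t : Fin k → ZMod p} (hst : ¬∃ σ : Equiv.Perm (Fin k), t = s ∘ σ) :
    ‖psiCorrelation x y s t‖ ≤ 4 * k * √p := by
  obtain ⟨z, hz⟩ := not_forall.1 (mt exists_perm_of_card_fiber_eq hst)
  set W : Finset (ZMod p) :=
    (Finset.univ.image fun i => -s i) ∪ (Finset.univ.image fun i => -t i) with hW
  have hsW : ∀ i, -s i ∈ W := fun i =>
    Finset.mem_union_left _ (Finset.mem_image_of_mem _ (Finset.mem_univ i))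
  have htW : ∀ i, -t i ∈ W := fun i =>
    Finset.mem_union_right _ (Finset.mem_image_of_mem _ (Finset.mem_univ i))
  set c : ZMod p → ZMod p := fun w =>
    y * ((∑ i, if w = -s i then 1 else 0) - ∑ i, if w = -t i then 1 else 0) with hc
  have hWcard : W.card ≤ 2 * k := by
    have h1 := (Finset.card_image_le (s := Finset.univ) (f := fun i : Fin k => -s i))
    have h2 := (Finset.card_image_le (s := Finset.univ) (f := fun i : Fin k => -t i))
    rw [Finset.card_univ, Fintype.card_fin] at h1 h2
    exact (Finset.card_union_le _ _).trans (by omega)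
  have hcz : c (-z) ≠ 0 := by
    simp only [hc, neg_inj, Finset.sum_boole, eq_comm (a := z)]
    refine mul_ne_zero hy (sub_ne_zero.2 fun h => hz ?_)
    have hle : ∀ f : Fin k → ZMod p, (Finset.univ.filter fun i => f i = z).card < p := fun f =>
      ((Finset.card_le_univ _).trans_eq (Fintype.card_fin k)).trans_lt hkp
    rw [ZMod.natCast_eq_natCast_iff', Nat.mod_eq_of_lt (hle s), Nat.mod_eq_of_lt (hle t)] at h
    convert h
  have hzW : -z ∈ W := by
    by_contra hzW
    refine hcz ?_
    have h1 : ∀ i, -z ≠ -s i := fun i h => hzW (h ▸ hsW i)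
    have h2 : ∀ i, -z ≠ -t i := fun i h => hzW (h ▸ htW i)
    simp only [hc, if_neg (h1 _), if_neg (h2 _), sub_self, mul_zero]
  have hsum : ∀ u, ∑ w ∈ W, c w * (u - w)⁻¹ =
      y * ∑ i, (u + s i)⁻¹ - y * ∑ i, (u + t i)⁻¹ := by
    have key : ∀ (f : Fin k → ZMod p) (u : ZMod p), (∀ i, -f i ∈ W) →
        ∑ w ∈ W, (∑ i, if w = -f i then 1 else 0) * (u - w)⁻¹ = ∑ i, (u + f i)⁻¹ := by
      intro f u hf
      simp only [Finset.sum_mul, ite_mul, one_mul, zero_mul]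
      rw [Finset.sum_comm]
      refine Finset.sum_congr rfl fun i _ => ?_
      rw [Finset.sum_ite_eq', if_pos (hf i), sub_neg_eq_add]
    intro u
    rw [← key s u hsW, ← key t u htW, ← mul_sub, ← Finset.sum_sub_distrib, Finset.mul_sum]
    refine Finset.sum_congr rfl fun w _ => ?_
    simp only [hc]
    ring
  have hterm : ∀ u, (∏ i, psi p x y (u + s i)) * conj (∏ i, psi p x y (u + t i)) =
      ZMod.stdAddChar (x * ∑ i, s i - x * ∑ i, t i) *
        if ∀ w ∈ W, u ≠ w then ZMod.stdAddChar (∑ w ∈ W, c w * (u - w)⁻¹) else (0 : ℂ) := by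
    intro u
    split_ifs with hu
    · have hs : ∀ i, u + s i ≠ 0 := fun i h => hu _ (hsW i) (eq_neg_of_add_eq_zero_left h)
      have ht : ∀ i, u + t i ≠ 0 := fun i h => hu _ (htW i) (eq_neg_of_add_eq_zero_left h)
      rw [prod_psi_of_ne_zero x y u hs, prod_psi_of_ne_zero x y u ht, ← AddChar.map_neg_eq_conj,
        ← AddChar.map_add_eq_mul, ← AddChar.map_add_eq_mul, hsum]
      congr 1
      simp only [Finset.sum_add_distrib, ← Finset.mul_sum]
      ring
    · push Not at hu
      obtain ⟨w, hw, rfl⟩ := hu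
      rw [mul_zero]
      rcases Finset.mem_union.1 hw with h | h
      · obtain ⟨i, -, hi⟩ := Finset.mem_image.1 h
        rw [Finset.prod_eq_zero (Finset.mem_univ i), zero_mul]
        rw [← hi, neg_add_cancel, psi_zero]
      · obtain ⟨i, -, hi⟩ := Finset.mem_image.1 h
        rw [Finset.prod_eq_zero (Finset.mem_univ i) (f := fun i => psi p x y (u + t i)), map_zero,
          mul_zero]
        rw [← hi, neg_add_cancel, psi_zero]
  rw [psiCorrelation, Finset.sum_congr rfl fun u _ => hterm u, ← Finset.mul_sum, norm_mul,
    AddChar.norm_apply, one_mul]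
  refine (norm_sum_stdAddChar_simple_poles_le hzW hcz).trans ?_
  have h : (W.card : ℝ) ≤ 2 * k := by exact_mod_cast hWcard
  nlinarith [Real.sqrt_nonneg (p : ℝ)]

lemma sum_norm_pow_eq_sum_psiCorrelation (k : ℕ) (x y : ZMod p) (V : Finset (ZMod p))
    (b : ZMod p → ℂ) :
    ((∑ u : ZMod p, ‖∑ v ∈ V, b v * psi p x y (u + v)‖ ^ (2 * k) : ℝ) : ℂ) =
      ∑ s ∈ Fintype.piFinset fun _ : Fin k => V, ∑ t ∈ Fintype.piFinset fun _ : Fin k => V,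
        (∏ i, b (s i)) * conj (∏ i, b (t i)) * psiCorrelation x y s t := by
  have h : ∀ u : ZMod p, ((‖∑ v ∈ V, b v * psi p x y (u + v)‖ ^ (2 * k) : ℝ) : ℂ) =
      ∑ s ∈ Fintype.piFinset fun _ : Fin k => V, ∑ t ∈ Fintype.piFinset fun _ : Fin k => V,
        (∏ i, b (s i)) * conj (∏ i, b (t i)) *
          ((∏ i, psi p x y (u + s i)) * conj (∏ i, psi p x y (u + t i))) := by
    intro u
    rw [pow_mul, ← Complex.normSq_eq_norm_sq, Complex.ofReal_pow, ← Complex.mul_conj, mul_pow,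
      ← map_pow, Finset.sum_pow', map_sum, Finset.sum_mul_sum]
    refine Finset.sum_congr rfl fun s _ => Finset.sum_congr rfl fun t _ => ?_
    simp only [Finset.prod_mul_distrib, map_mul]
    ring
  rw [Complex.ofReal_sum, Finset.sum_congr rfl fun u _ => h u, Finset.sum_comm]
  refine Finset.sum_congr rfl fun s _ => ?_
  rw [Finset.sum_comm]
  refine Finset.sum_congr rfl fun t _ => ?_
  rw [psiCorrelation, Finset.mul_sum]

open Classical in
lemma sum_norm_pow_le_of_lt {k : ℕ} (hkp : k < p) {x y : ZMod p} (hy : y ≠ 0)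
    (V : Finset (ZMod p)) {b : ZMod p → ℂ} {B : ℝ} (hb : ∀ v ∈ V, ‖b v‖ ≤ B) (hB : 0 ≤ B) :
    ∑ u : ZMod p, ‖∑ v ∈ V, b v * psi p x y (u + v)‖ ^ (2 * k) ≤
      B ^ (2 * k) * (k.factorial * V.card ^ k * p + 4 * k * V.card ^ (2 * k) * √p) := by
  set T := Fintype.piFinset fun _ : Fin k => V with hT
  have hTcard : T.card = V.card ^ k := by
    rw [hT, Fintype.card_piFinset_const]
  have hprod : ∀ s ∈ T, ‖∏ i, b (s i)‖ ≤ B ^ k := by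
    intro s hs
    rw [norm_prod]
    refine (Finset.prod_le_prod (fun _ _ => norm_nonneg _)
      fun i _ => hb _ (Fintype.mem_piFinset.1 hs i)).trans ?_
    simp
  have hperm : ∀ s : Fin k → ZMod p,
      (T.filter fun t => ∃ σ : Equiv.Perm (Fin k), t = s ∘ σ).card ≤ k.factorial := by
    intro s
    refine (Finset.card_le_card (t := Finset.univ.image fun σ : Equiv.Perm (Fin k) => s ∘ σ)
      ?_).trans (Finset.card_image_le.trans ?_)
    · intro t ht
      obtain ⟨σ, hσ⟩ := (Finset.mem_filter.1 ht).2
      exact Finset.mem_image.2 ⟨σ, Finset.mem_univ _, hσ.symm⟩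
    · rw [Finset.card_univ, Fintype.card_perm, Fintype.card_fin]
  have hterm : ∀ s ∈ T, ∀ t ∈ T,
      ‖(∏ i, b (s i)) * conj (∏ i, b (t i)) * psiCorrelation x y s t‖ ≤
        B ^ (2 * k) *
          ((if ∃ σ : Equiv.Perm (Fin k), t = s ∘ σ then (p : ℝ) else 0) + 4 * k * √p) := by
    intro s hs t ht
    rw [norm_mul, norm_mul, RCLike.norm_conj, two_mul, pow_add]
    refine mul_le_mul (mul_le_mul (hprod s hs) (hprod t ht) (norm_nonneg _) (by positivity)) ?_
      (norm_nonneg _) (by positivity)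
    split_ifs with h
    · exact (norm_psiCorrelation_le x y s t).trans (le_add_of_nonneg_right (by positivity))
    · rw [zero_add]
      exact norm_psiCorrelation_le_sqrt hkp hy h
  have hinner : ∀ s ∈ T,
      ‖∑ t ∈ T, (∏ i, b (s i)) * conj (∏ i, b (t i)) * psiCorrelation x y s t‖ ≤
        B ^ (2 * k) * (k.factorial * p + V.card ^ k * (4 * k * √p)) := by
    intro s hs
    refine (norm_sum_le_of_le _ (hterm s hs)).trans ?_
    rw [← Finset.mul_sum, Finset.sum_add_distrib, Finset.sum_const, hTcard, nsmul_eq_mul,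
      ← Finset.sum_filter, Finset.sum_const, nsmul_eq_mul, Nat.cast_pow]
    have := hperm s
    gcongr
  have h := norm_sum_le_of_le _ hinner
  rw [← sum_norm_pow_eq_sum_psiCorrelation, Complex.norm_real, Finset.sum_const, hTcard,
    nsmul_eq_mul, Nat.cast_pow] at h
  refine (Real.le_norm_self _).trans (h.trans_eq ?_)
  ring

lemma sum_norm_pow_le {k : ℕ} (hk : 0 < k) {x y : ZMod p} (hy : y ≠ 0)
    (V : Finset (ZMod p)) {b : ZMod p → ℂ} {B : ℝ} (hb : ∀ v ∈ V, ‖b v‖ ≤ B) (hB : 0 ≤ B) :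
    ∑ u : ZMod p, ‖∑ v ∈ V, b v * psi p x y (u + v)‖ ^ (2 * k) ≤
      B ^ (2 * k) * (k.factorial * V.card ^ k * p + 4 * k * V.card ^ (2 * k) * √p) := by
  rcases lt_or_ge k p with hkp | hpk
  · exact sum_norm_pow_le_of_lt hkp hy V hb hB
  have hu : ∀ u : ZMod p, ‖∑ v ∈ V, b v * psi p x y (u + v)‖ ≤ V.card * B := by
    intro u
    refine (norm_sum_le_of_le (n := fun _ => B) _ fun v hv => ?_).trans_eq (by simp)
    rw [norm_mul]
    exact (mul_le_of_le_one_right (norm_nonneg _) (norm_psi_le_one x y _)).trans (hb v hv)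
  have hpk' : (p : ℝ) ≤ k := by exact_mod_cast hpk
  have hk1 : (1 : ℝ) ≤ k := by exact_mod_cast hk
  have hp : (p : ℝ) ≤ 4 * k * √p := by
    have h1 := Real.mul_self_sqrt (Nat.cast_nonneg (α := ℝ) p)
    have h2 : √(p : ℝ) ≤ k := Real.sqrt_le_iff.2 ⟨by positivity, by nlinarith⟩
    nlinarith [Real.sqrt_nonneg (p : ℝ)]
  calc ∑ u : ZMod p, ‖∑ v ∈ V, b v * psi p x y (u + v)‖ ^ (2 * k)
      ≤ ∑ _u : ZMod p, (V.card * B) ^ (2 * k) :=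
        Finset.sum_le_sum fun u _ => pow_le_pow_left₀ (norm_nonneg _) (hu u) _
    _ = B ^ (2 * k) * (V.card ^ (2 * k) * p) := by
        rw [Finset.sum_const, Finset.card_univ, ZMod.card, nsmul_eq_mul]
        ring
    _ ≤ B ^ (2 * k) * (V.card ^ (2 * k) * (4 * k * √p)) := by gcongr
    _ ≤ _ := by
        refine mul_le_mul_of_nonneg_left ?_ (by positivity)
        have : (0 : ℝ) ≤ k.factorial * V.card ^ k * p := by positivity
        linarith

end psi

end

theorem stmt_5 (k : ℕ) (hk : 0 < k) :
    ∃ C > (0 : ℝ), ∀ p : ℕ, p.Prime → ∀ (U V : Finset (ZMod p))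
      (a b : ZMod p → ℂ) (A B : ℝ),
      (∀ u ∈ U, ‖a u‖ ≤ A) → (∀ v ∈ V, ‖b v‖ ≤ B) →
      ∀ x y : ZMod p, y ≠ 0 →
      ‖∑ u ∈ U, ∑ v ∈ V, a u * b v * psi p x y (u + v)‖ ≤
        C * A * B * (U.card : ℝ) ^ (1 - 1 / (2 * (k : ℝ))) *
          ((V.card : ℝ) ^ ((1 : ℝ) / 2) * (p : ℝ) ^ (1 / (2 * (k : ℝ)))
            + (V.card : ℝ) * (p : ℝ) ^ (1 / (4 * (k : ℝ)))) := by
  have hk0 : (k : ℝ) ≠ 0 := by exact_mod_cast hk.ne'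
  have hk1 : (1 : ℝ) ≤ k := by exact_mod_cast hk
  set C : ℝ := k.factorial + 4 * k with hC
  have hC1 : 1 ≤ C := by
    have : (0 : ℝ) ≤ k.factorial := by positivity
    linarith
  refine ⟨C, by linarith, fun p hp U V a b A B ha hb x y hy => ?_⟩
  have : Fact p.Prime := ⟨hp⟩
  rcases U.eq_empty_or_nonempty with rfl | ⟨u₀, hu₀⟩
  · have h : 1 - 1 / (2 * (k : ℝ)) ≠ 0 := by
      have : 1 / (2 * (k : ℝ)) ≤ 1 / 2 := by
        rw [div_le_div_iff₀ (by positivity) (by norm_num)]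
        linarith
      linarith
    simp only [Finset.sum_empty, norm_zero, Finset.card_empty, Nat.cast_zero, Real.zero_rpow h,
      mul_zero, zero_mul, le_refl]
  rcases V.eq_empty_or_nonempty with rfl | ⟨v₀, hv₀⟩
  · have h : (1 : ℝ) / 2 ≠ 0 := by norm_num
    simp only [Finset.sum_empty, Finset.sum_const_zero, norm_zero, Finset.card_empty,
      Nat.cast_zero, Real.zero_rpow h, mul_zero, zero_mul, add_zero, le_refl]
  have hA : 0 ≤ A := (norm_nonneg _).trans (ha u₀ hu₀)
  have hB : 0 ≤ B := (norm_nonneg _).trans (hb v₀ hv₀)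
  set F : ZMod p → ℝ := fun u => ‖∑ v ∈ V, b v * psi p x y (u + v)‖ with hF
  have hF0 : ∀ u, 0 ≤ F u := fun u => norm_nonneg _
  have hLHS : ‖∑ u ∈ U, ∑ v ∈ V, a u * b v * psi p x y (u + v)‖ ≤ A * ∑ u ∈ U, F u := by
    rw [Finset.mul_sum]
    refine norm_sum_le_of_le _ fun u hu => ?_
    simp only [mul_assoc]
    rw [← Finset.mul_sum, norm_mul]
    exact mul_le_mul_of_nonneg_right (ha u hu) (norm_nonneg _)
  set P : ℝ := (U.card : ℝ) ^ (1 - 1 / (2 * (k : ℝ))) with hP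
  set M₁ : ℝ := (V.card : ℝ) ^ ((1 : ℝ) / 2) * (p : ℝ) ^ (1 / (2 * (k : ℝ))) with hM₁
  set M₂ : ℝ := (V.card : ℝ) * (p : ℝ) ^ (1 / (4 * (k : ℝ))) with hM₂
  have hP0 : 0 ≤ P := by positivity
  have hM₁0 : 0 ≤ M₁ := by positivity
  have hM₂0 : 0 ≤ M₂ := by positivity
  have hPk : P ^ (2 * k) = (U.card : ℝ) ^ (2 * k - 1) := by
    rw [hP, ← Real.rpow_mul_natCast (by positivity), ← Real.rpow_natCast,
      Nat.cast_sub (by omega)]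
    congr 1
    push_cast
    field_simp
  have hM₁k : M₁ ^ (2 * k) = (V.card : ℝ) ^ k * p := by
    rw [hM₁, mul_pow, ← Real.rpow_mul_natCast (by positivity),
      ← Real.rpow_mul_natCast (by positivity)]
    have h1 : 1 / 2 * ((2 * k : ℕ) : ℝ) = k := by
      push_cast
      ring
    have h2 : 1 / (2 * (k : ℝ)) * ((2 * k : ℕ) : ℝ) = 1 := by
      push_cast
      field_simp
    rw [h1, h2, Real.rpow_natCast, Real.rpow_one]
  have hM₂k : M₂ ^ (2 * k) = (V.card : ℝ) ^ (2 * k) * √p := by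
    rw [hM₂, mul_pow, ← Real.rpow_mul_natCast (by positivity), Real.sqrt_eq_rpow]
    congr 2
    push_cast
    field_simp
    norm_num
  have hHolder : (∑ u ∈ U, F u) ^ (2 * k) ≤
      (U.card : ℝ) ^ (2 * k - 1) * ∑ u ∈ U, F u ^ (2 * k) := by
    have h := pow_sum_le_card_mul_sum_pow (s := U) (f := F) (fun u _ => hF0 u) (2 * k - 1)
    rwa [Nat.sub_add_cancel (by omega)] at h
  have hmoment : ∑ u ∈ U, F u ^ (2 * k) ≤
      B ^ (2 * k) * (k.factorial * V.card ^ k * p + 4 * k * V.card ^ (2 * k) * √p) :=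
    (Finset.sum_le_sum_of_subset_of_nonneg (Finset.subset_univ U)
      fun u _ _ => pow_nonneg (hF0 u) _).trans (sum_norm_pow_le hk hy V hb hB)
  have hCM : k.factorial * (V.card : ℝ) ^ k * p + 4 * k * (V.card : ℝ) ^ (2 * k) * √p ≤
      C ^ (2 * k) * (M₁ + M₂) ^ (2 * k) := by
    have h1 : M₁ ^ (2 * k) + M₂ ^ (2 * k) ≤ (M₁ + M₂) ^ (2 * k) :=
      pow_add_pow_le hM₁0 hM₂0 (by omega)
    have h2 : C ≤ C ^ (2 * k) := le_self_pow₀ hC1 (by omega)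
    calc k.factorial * (V.card : ℝ) ^ k * p + 4 * k * (V.card : ℝ) ^ (2 * k) * √p
        = k.factorial * M₁ ^ (2 * k) + 4 * k * M₂ ^ (2 * k) := by
          rw [hM₁k, hM₂k]
          ring
      _ ≤ C * M₁ ^ (2 * k) + C * M₂ ^ (2 * k) := by
          gcongr
          · exact le_add_of_nonneg_right (by positivity)
          · exact le_add_of_nonneg_left (by positivity)
      _ = C * (M₁ ^ (2 * k) + M₂ ^ (2 * k)) := by ring
      _ ≤ _ := by gcongr
  have hsum : ∑ u ∈ U, F u ≤ C * B * P * (M₁ + M₂) := by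
    refine le_of_pow_le_pow_left₀ (n := 2 * k) (by omega) (by positivity) ?_
    calc (∑ u ∈ U, F u) ^ (2 * k)
        ≤ (U.card : ℝ) ^ (2 * k - 1) * (B ^ (2 * k) * (C ^ (2 * k) * (M₁ + M₂) ^ (2 * k))) :=
          hHolder.trans (mul_le_mul_of_nonneg_left (hmoment.trans
            (mul_le_mul_of_nonneg_left hCM (by positivity))) (by positivity))
      _ = (C * B * P * (M₁ + M₂)) ^ (2 * k) := by
          rw [← hPk, mul_pow, mul_pow, mul_pow]
          ring
  calc _ ≤ A * ∑ u ∈ U, F u := hLHS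
    _ ≤ A * (C * B * P * (M₁ + M₂)) := mul_le_mul_of_nonneg_left hsum hA
    _ = _ := by ring
end

section
/- There is an absolute constant C > 0 with the following property. Let p be a prime, let 𝒰, 𝒱 ⊆ 𝔽_p be subsets of cardinalities U = #𝒰 and V = #𝒱, let a : 𝒰 → ℂ and b : 𝒱 → ℂ be complex weights with |a_u| ≤ A for all u ∈ 𝒰 and |b_v| ≤ B for all v ∈ 𝒱, and let x, y ∈ 𝔽_p with y ≠ 0. Then |∑_{u ∈ 𝒰} ∑_{v ∈ 𝒱} a_u·b_v·ψ_{x,y;p}(u+v)| ≤ C·A·B·U^{1/2}·V^{1/2}·p^{1/2}. -/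
open Finset

section Stepanov

open Polynomial

lemma Polynomial.exists_sum_smul_eq_zero {K ι : Type*} [Field K] [Fintype ι] {D : ℕ}
    (v : ι → K[X]) (hv : ∀ i, (v i).natDegree < D) (hD : D < Fintype.card ι) :
    ∃ g : ι → K, ∑ i, g i • v i = 0 ∧ ∃ i, g i ≠ 0 := by
  have hmem : ∀ i, v i ∈ degreeLT K D := fun i ↦
    mem_degreeLT.2 (degree_le_natDegree.trans_lt (by exact_mod_cast hv i))
  have hfin : Module.finrank K (degreeLT K D) = D := by
    rw [(degreeLTEquiv K D).finrank_eq, Module.finrank_fin_fun]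
  have : Module.Finite K (degreeLT K D) := Module.Finite.equiv (degreeLTEquiv K D).symm
  have hli : ¬ LinearIndependent K (fun i ↦ (⟨v i, hmem i⟩ : degreeLT K D)) := fun h ↦ by
    have := h.fintype_card_le_finrank
    omega
  obtain ⟨g, hg, hi⟩ := Fintype.not_linearIndependent_iff.1 hli
  refine ⟨g, ?_, hi⟩
  simpa using congrArg Subtype.val hg

lemma Polynomial.sum_smul_ne_zero_of_injective_natDegree {K ι : Type*} [Field K] [Fintype ι]
    (v : ι → K[X]) (h0 : ∀ i, v i ≠ 0) (hinj : Function.Injective fun i ↦ (v i).natDegree)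
    (g : ι → K) {i : ι} (hi : g i ≠ 0) : ∑ i, g i • v i ≠ 0 := by
  intro h
  have hd := degree_sum_eq_of_disjoint (fun i ↦ g i • v i) univ (by
    intro x hx y hy hxy
    have hx' : g x ≠ 0 := fun h ↦ hx.2 (by simp [h])
    have hy' : g y ≠ 0 := fun h ↦ hy.2 (by simp [h])
    intro he
    simp only [Function.comp_apply, degree_smul_of_smul_regular _ (IsSMulRegular.of_ne_zero hx'),
      degree_smul_of_smul_regular _ (IsSMulRegular.of_ne_zero hy')] at he
    exact hxy (hinj (natDegree_eq_of_degree_eq he)))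
  rw [h, degree_zero] at hd
  have := (Finset.sup_eq_bot_iff _ _).1 hd.symm i (mem_univ i)
  rw [degree_eq_bot, smul_eq_zero] at this
  exact this.elim hi (h0 i)

/-- The sum `w + w ^ p + ⋯ + w ^ (p ^ (n - 1))`, which on the field with `p ^ n` elements is the
trace to the prime field. -/
def frobSum {R : Type*} [CommSemiring R] (p n : ℕ) (w : R) : R := ∑ i ∈ range n, w ^ p ^ i

lemma frobSum_add_pow {p : ℕ} [Fact p.Prime] {R : Type*} [CommSemiring R] [CharP R p]
    (m n : ℕ) (w : R) :
    frobSum p n w + frobSum p m w ^ p ^ n = frobSum p (n + m) w := by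
  rw [frobSum, frobSum, frobSum, sum_range_add, sum_pow_char_pow]
  simp_rw [← pow_mul, ← pow_add, add_comm]

/-- For `P = p ^ m`, this is `X ^ P` times `frobSum p (m + 1) (a X + b / X)`. -/
noncomputable def stepanovPoly (p : ℕ) (m : ℕ) (a b : ZMod p) : (ZMod p)[X] :=
  ∑ i ∈ range (m + 1), (C a * X ^ (p ^ m + p ^ i) + C b * X ^ (p ^ m - p ^ i))

lemma natDegree_stepanovPoly {p : ℕ} [hp : Fact p.Prime] (m : ℕ) {a : ZMod p} (b : ZMod p)
    (ha : a ≠ 0) : (stepanovPoly p m a b).natDegree = 2 * p ^ m := by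
  have hP : 0 < p ^ m := pow_pos hp.out.pos m
  refine natDegree_eq_of_le_of_coeff_ne_zero ?_ ?_
  · refine natDegree_sum_le_of_forall_le _ _ fun i hi ↦ ?_
    have : p ^ i ≤ p ^ m := Nat.pow_le_pow_right hp.out.pos (by simp at hi; omega)
    refine (natDegree_add_le _ _).trans (max_le ?_ ?_)
    · exact (natDegree_C_mul_X_pow_le _ _).trans (by omega)
    · exact (natDegree_C_mul_X_pow_le _ _).trans (by omega)
  · rw [stepanovPoly, finsetSum_coeff, Finset.sum_eq_single m]
    · rw [coeff_add, coeff_C_mul_X_pow, coeff_C_mul_X_pow, if_pos (by omega), if_neg (by omega)]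
      simpa using ha
    · intro i hi him
      have : p ^ i < p ^ m := Nat.pow_lt_pow_right hp.out.one_lt (by simp at hi; omega)
      rw [coeff_add, coeff_C_mul_X_pow, coeff_C_mul_X_pow, if_neg (by omega), if_neg (by omega),
        add_zero]
    · simp

variable {p : ℕ} [hp : Fact p.Prime] {Ω : Type*} [Field Ω] [Algebra (ZMod p) Ω]

lemma algebraMap_pow_char_pow (a : ZMod p) (i : ℕ) :
    (algebraMap (ZMod p) Ω a) ^ p ^ i = algebraMap (ZMod p) Ω a := by
  rw [← map_pow, ZMod.pow_card_pow]

variable [CharP Ω p]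

lemma kloostermanArg_pow (a b : ZMod p) (x : Ω) (i : ℕ) :
    (algebraMap (ZMod p) Ω a * x + algebraMap (ZMod p) Ω b * x⁻¹) ^ p ^ i =
      algebraMap (ZMod p) Ω a * x ^ p ^ i + algebraMap (ZMod p) Ω b * (x ^ p ^ i)⁻¹ := by
  rw [add_pow_char_pow, mul_pow, mul_pow, algebraMap_pow_char_pow, algebraMap_pow_char_pow,
    inv_pow]

lemma aeval_stepanovPoly (m : ℕ) (a b : ZMod p) {x : Ω} (hx : x ≠ 0) :
    aeval x (stepanovPoly p m a b) = x ^ p ^ m *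
      frobSum p (m + 1) (algebraMap (ZMod p) Ω a * x + algebraMap (ZMod p) Ω b * x⁻¹) := by
  rw [stepanovPoly, map_sum, frobSum, mul_sum]
  refine Finset.sum_congr rfl fun i hi ↦ ?_
  have : p ^ i ≤ p ^ m := Nat.pow_le_pow_right hp.out.pos (by simp at hi; omega)
  rw [kloostermanArg_pow]
  simp only [map_add, map_mul, aeval_C, map_pow, aeval_X]
  rw [pow_add, pow_sub₀ _ hx this]
  ring

/-- Stepanov's method: the number of solutions of `Tr (a x + b / x) = c` in the field with
`Q ^ 2` elements, `Q = p ^ (m + 1)`, exceeds the expected `Q ^ 2 / p` by at most `4 Q`. -/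
theorem card_le_of_frobSum_eq (m : ℕ) {a : ZMod p} (b c : ZMod p) (ha : a ≠ 0) (s : Finset Ω)
    (hs : ∀ x ∈ s, x ≠ 0 ∧ x ^ p ^ (2 * (m + 1)) = x ∧
      frobSum p (2 * (m + 1)) (algebraMap (ZMod p) Ω a * x + algebraMap (ZMod p) Ω b * x⁻¹) =
        algebraMap (ZMod p) Ω c) :
    s.card ≤ p ^ m * p ^ (m + 1) + 4 * p ^ (m + 1) := by
  have hp2 := hp.out.two_le
  obtain ⟨r, hr⟩ : ∃ r, p = r + 1 := ⟨p - 1, by omega⟩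
  set P := p ^ m with hP
  have hP0 : 0 < P := pow_pos hp.out.pos m
  set Q := p ^ (m + 1) with hQ
  have hQP : Q = P * p := pow_succ p m
  have hQP' : Q = P * r + P := by rw [hQP, hr]; ring
  set S := stepanovPoly p m a b with hS
  have hSd : S.natDegree = 2 * P := natDegree_stepanovPoly m b ha
  have hS0 : S ≠ 0 := fun h ↦ by rw [h, natDegree_zero] at hSd; omega
  let v : Fin P × Fin p × Fin (P + 2) → (ZMod p)[X] := fun i ↦
    X ^ (Q * i.1.1 + i.2.2.1) * (C c * X ^ P - S) ^ i.2.1.1 * X ^ (P * (r - i.2.1.1))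
  let w : Fin P × Fin p × Fin (P + 2) → (ZMod p)[X] := fun i ↦
    X ^ (i.1.1 + Q * i.2.2.1) * S ^ i.2.1.1 * X ^ (P * (r - i.2.1.1))
  have hw0 : ∀ i, w i ≠ 0 := fun i ↦ by simp [w, hS0]
  have hwd : ∀ i, (w i).natDegree = i.1.1 + P * i.2.1.1 + Q * i.2.2.1 + P * r := by
    rintro ⟨⟨i, hi⟩, ⟨k, hk⟩, ⟨j, hj⟩⟩
    obtain ⟨d, hd⟩ : ∃ d, r = k + d := ⟨r - k, by omega⟩
    simp only [w]
    rw [natDegree_mul (by simp [hS0]) (by simp), natDegree_mul (by simp) (by simp [hS0]),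
      natDegree_pow, natDegree_pow, natDegree_pow, natDegree_X, hSd, hd, Nat.add_sub_cancel_left]
    ring
  have hwinj : Function.Injective fun i ↦ (w i).natDegree := by
    rintro ⟨⟨i, hi⟩, ⟨k, hk⟩, ⟨j, hj⟩⟩ ⟨⟨i', hi'⟩, ⟨k', hk'⟩, ⟨j', hj'⟩⟩ h
    simp only [hwd, hQP] at h
    have h1 : i + P * (k + p * j) = i' + P * (k' + p * j') := by linarith
    have h2 := congrArg (· % P) h1
    have h3 := congrArg (· / P) h1
    simp only [Nat.add_mul_mod_self_left, Nat.mod_eq_of_lt hi, Nat.mod_eq_of_lt hi'] at h2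
    simp only [Nat.add_mul_div_left _ _ hP0, Nat.div_eq_of_lt hi, Nat.div_eq_of_lt hi',
      zero_add] at h3
    have h4 := congrArg (· % p) h3
    have h5 := congrArg (· / p) h3
    simp only [Nat.add_mul_mod_self_left, Nat.mod_eq_of_lt hk, Nat.mod_eq_of_lt hk'] at h4
    simp only [Nat.add_mul_div_left _ _ hp.out.pos, Nat.div_eq_of_lt hk, Nat.div_eq_of_lt hk',
      zero_add] at h5
    simp [h2, h4, h5]
  have hvd : ∀ i, (v i).natDegree < Q * P + 2 * (P * r) + (P + 2) - Q := by
    rintro ⟨⟨i, hi⟩, ⟨k, hk⟩, ⟨j, hj⟩⟩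
    obtain ⟨d, hd⟩ : ∃ d, r = k + d := ⟨r - k, by omega⟩
    simp only [v]
    have h1 : (C c * X ^ P - S).natDegree ≤ 2 * P :=
      (natDegree_sub_le _ _).trans (max_le ((natDegree_C_mul_X_pow_le _ _).trans (by omega))
        hSd.le)
    have h2 : (X ^ (Q * i + j) * (C c * X ^ P - S) ^ k * X ^ (P * (r - k))).natDegree ≤
        (Q * i + j) + k * (2 * P) + P * (r - k) :=
      natDegree_mul_le_of_le (natDegree_mul_le_of_le (natDegree_X_pow_le _)
        (natDegree_pow_le_of_le _ h1)) (natDegree_X_pow_le _)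
    refine h2.trans_lt ?_
    have h3 : Q * (i + 1) ≤ Q * P := Nat.mul_le_mul_left _ hi
    have h4 : r - k = d := by omega
    rw [h4, hd]
    have h5 : Q * (i + 1) = Q * i + Q := by ring
    have h6 : 2 * (P * (k + d)) = k * (2 * P) + 2 * (P * d) := by ring
    omega
  obtain ⟨g, hg, i₀, hi₀⟩ := exists_sum_smul_eq_zero v hvd (by
    simp only [Fintype.card_prod, Fintype.card_fin]
    have h1 : P * (p * (P + 2)) = Q * P + 2 * Q := by rw [hQP]; ring
    have h2 : Q * P + 2 * Q = Q * P + 2 * (P * r) + 2 * P := by rw [hQP']; ring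
    have h3 : P * 1 ≤ P * r := Nat.mul_le_mul_left _ (by omega)
    rw [h1, h2]
    omega)
  set G := ∑ i, g i • w i with hG
  have hG0 : G ≠ 0 := sum_smul_ne_zero_of_injective_natDegree w hw0 hwinj g hi₀
  have hGd : G.natDegree ≤ P * Q + 4 * Q := by
    refine natDegree_sum_le_of_forall_le _ _ fun i _ ↦ (natDegree_smul_le _ _).trans ?_
    rw [hwd]
    obtain ⟨⟨i, hi⟩, ⟨k, hk⟩, ⟨j, hj⟩⟩ := i
    simp only
    have h1 : Q * j ≤ Q * (P + 1) := Nat.mul_le_mul_left _ (by omega)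
    have h2 : P * k ≤ P * r := Nat.mul_le_mul_left _ (by omega)
    have h3 : Q * (P + 1) = P * Q + Q := by ring
    omega
  have hroot : ∀ x ∈ s, aeval x G = 0 := by
    intro x hx
    obtain ⟨hx0, hxq, hxc⟩ := hs x hx
    have hxQ : (x ^ Q) ^ Q = x := by rw [← pow_mul, hQ, ← pow_add, ← two_mul, hxq]
    set T := frobSum p (m + 1) (algebraMap (ZMod p) Ω a * x + algebraMap (ZMod p) Ω b * x⁻¹)
      with hT
    have hST : aeval x S = x ^ P * T := aeval_stepanovPoly m a b hx0
    have hTQ : T ^ Q = algebraMap (ZMod p) Ω c - T := by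
      rw [← hxc, two_mul, ← frobSum_add_pow]; ring
    have hwx : ∀ i, aeval x (w i) = x ^ (P * r) * (x ^ (i.1.1 + Q * i.2.2.1) * T ^ i.2.1.1) := by
      rintro ⟨⟨i, hi⟩, ⟨k, hk⟩, ⟨j, hj⟩⟩
      obtain ⟨d, hd⟩ : ∃ d, r = k + d := ⟨r - k, by omega⟩
      simp only [w, map_mul, map_pow, aeval_X, hST, hd, Nat.add_sub_cancel_left]
      ring
    have hvx : ∀ i, aeval x (v i) =
        x ^ (P * r) * (x ^ (i.1.1 + Q * i.2.2.1) * T ^ i.2.1.1) ^ Q := by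
      rintro ⟨⟨i, hi⟩, ⟨k, hk⟩, ⟨j, hj⟩⟩
      obtain ⟨d, hd⟩ : ∃ d, r = k + d := ⟨r - k, by omega⟩
      have h1 : (x ^ (i + Q * j) * T ^ k) ^ Q = x ^ (Q * i + j) * (T ^ Q) ^ k := by
        have : (x ^ (i + Q * j)) ^ Q = x ^ (Q * i) * ((x ^ Q) ^ Q) ^ j := by ring
        rw [mul_pow, this, hxQ]; ring
      simp only [v, map_mul, map_pow, map_sub, aeval_C, aeval_X, hST, hd, Nat.add_sub_cancel_left,
        h1, hTQ]
      rw [show algebraMap (ZMod p) Ω c * x ^ P - x ^ P * T = x ^ P * (algebraMap (ZMod p) Ω c - T)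
        by ring, mul_pow]
      ring
    have hsum : ∑ i, algebraMap (ZMod p) Ω (g i) * (x ^ (i.1.1 + Q * i.2.2.1) * T ^ i.2.1.1) ^ Q
        = 0 := by
      have h := congrArg (aeval x) hg
      simp only [map_sum, map_smul, hvx, map_zero] at h
      simp only [Algebra.smul_def] at h
      have h' : x ^ (P * r) * ∑ i, algebraMap (ZMod p) Ω (g i) *
          (x ^ (i.1.1 + Q * i.2.2.1) * T ^ i.2.1.1) ^ Q = 0 := by
        rw [mul_sum, ← h]
        exact Finset.sum_congr rfl fun i _ ↦ by ring
      exact (mul_eq_zero.1 h').resolve_left (pow_ne_zero _ hx0)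
    have hsum' : (∑ i, algebraMap (ZMod p) Ω (g i) *
        (x ^ (i.1.1 + Q * i.2.2.1) * T ^ i.2.1.1)) ^ Q = 0 := by
      rw [hQ, sum_pow_char_pow, ← hsum]
      exact Finset.sum_congr rfl fun i _ ↦ by rw [mul_pow, algebraMap_pow_char_pow]
    have hsum'' := eq_zero_of_pow_eq_zero hsum'
    simp only [hG, map_sum, map_smul, hwx]
    simp only [Algebra.smul_def]
    rw [← mul_zero (x ^ (P * r)), ← hsum'', mul_sum]
    exact Finset.sum_congr rfl fun i _ ↦ by ring
  have hmap : G.map (algebraMap (ZMod p) Ω) ≠ 0 :=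
    (Polynomial.map_ne_zero_iff (algebraMap (ZMod p) Ω).injective).2 hG0
  calc s.card ≤ (G.map (algebraMap (ZMod p) Ω)).natDegree :=
        card_le_degree_of_subset_roots fun x hx ↦ (mem_roots hmap).2 (by
          rw [IsRoot.def, eval_map_algebraMap]; exact hroot x hx)
    _ ≤ _ := by rw [natDegree_map]; exact hGd

end Stepanov

section Kloosterman

open Polynomial

open Classical in
/-- The elements fixed by the `q`-th power map; inside an algebraic closure of `ZMod p` and for
`q` a power of `p`, this is the field with `q` elements. -/
noncomputable def fixedPts (Ω : Type*) [Field Ω] (q : ℕ) : Finset Ω :=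
  (X ^ q - X : Polynomial Ω).roots.toFinset

lemma mem_fixedPts {Ω : Type*} [Field Ω] {q : ℕ} (hq : 1 < q) {x : Ω} :
    x ∈ fixedPts Ω q ↔ x ^ q = x := by
  classical
  rw [fixedPts, Multiset.mem_toFinset, mem_roots (FiniteField.X_pow_card_sub_X_ne_zero Ω hq)]
  simp [sub_eq_zero]

lemma card_fixedPts {Ω : Type*} [Field Ω] [IsAlgClosed Ω] (p : ℕ) [hp : Fact p.Prime]
    [CharP Ω p] {n : ℕ} (hn : n ≠ 0) : (fixedPts Ω (p ^ n)).card = p ^ n := by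
  classical
  rw [fixedPts, Multiset.toFinset_card_of_nodup
    (nodup_roots (galois_poly_separable p _ (dvd_pow_self p hn))),
    ← (IsAlgClosed.splits _).natDegree_eq_card_roots,
    FiniteField.X_pow_card_pow_sub_X_natDegree_eq Ω hn hp.out.one_lt]

variable {p : ℕ} [hp : Fact p.Prime] {Ω : Type*} [Field Ω]

lemma mem_fixedPts_pow {n : ℕ} (hn : n ≠ 0) {x : Ω} :
    x ∈ fixedPts Ω (p ^ n) ↔ x ^ p ^ n = x :=
  mem_fixedPts (Nat.one_lt_pow hn hp.out.one_lt)

/-- Pairs of elements of the field with `q` elements together with elements of its quadratic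
extension cover every pair (trace, norm) exactly twice. -/
lemma card_pairs_add_card_conj [IsAlgClosed Ω] [CharP Ω p] [DecidableEq Ω] {n : ℕ} (hn : n ≠ 0)
    {s N : Ω} (hs : s ∈ fixedPts Ω (p ^ n)) (hN : N ∈ (fixedPts Ω (p ^ n)).erase 0) :
    (((fixedPts Ω (p ^ n)).erase 0 ×ˢ (fixedPts Ω (p ^ n)).erase 0).filter
        fun t ↦ (t.1 + t.2, t.1 * t.2) = (s, N)).card +
      (((fixedPts Ω (p ^ (2 * n))).erase 0).filter
        fun z ↦ (z + z ^ p ^ n, z * z ^ p ^ n) = (s, N)).card = 2 := by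
  obtain ⟨hN0, hN⟩ := mem_erase.1 hN
  have hn2 : 2 * n ≠ 0 := by omega
  rw [mem_fixedPts_pow hn] at hs hN
  obtain ⟨α, hα⟩ := IsAlgClosed.exists_root (X ^ 2 - C s * X + C N) (by
    rw [show (X ^ 2 - C s * X + C N : Polynomial Ω) = C 1 * X ^ 2 + C (-s) * X + C N by simp; ring,
      degree_quadratic one_ne_zero]
    decide)
  obtain ⟨β, hβ⟩ : ∃ β, s = α + β := ⟨s - α, by ring⟩
  have hαβ : N = α * β := by
    simp only [IsRoot.def, eval_add, eval_sub, eval_pow, eval_X, eval_mul, eval_C, hβ] at hα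
    linear_combination hα
  have hα0 : α ≠ 0 := fun h ↦ hN0 (by rw [hαβ, h, zero_mul])
  have hβ0 : β ≠ 0 := fun h ↦ hN0 (by rw [hαβ, h, mul_zero])
  have hs' : α ^ p ^ n + β ^ p ^ n = α + β := by rw [← add_pow_char_pow, ← hβ, hs]
  have hN' : α ^ p ^ n * β ^ p ^ n = α * β := by rw [← mul_pow, ← hαβ, hN]
  have hroot : ∀ z w : Ω, z + w = s → z * w = N → (z = α ∧ w = β) ∨ (z = β ∧ w = α) := by
    intro z w h1 h2
    have h3 : (z - α) * (z - β) = 0 := by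
      rw [hβ] at h1
      rw [hαβ] at h2
      linear_combination z * h1 - h2
    rcases mul_eq_zero.1 h3 with h | h
    · left
      have hz : z = α := sub_eq_zero.1 h
      exact ⟨hz, by rw [hβ, hz] at h1; exact add_left_cancel h1⟩
    · right
      have hz : z = β := sub_eq_zero.1 h
      exact ⟨hz, by rw [hβ, hz, add_comm α] at h1; exact add_left_cancel h1⟩
  have hfrob : (α ^ p ^ n = α ∧ β ^ p ^ n = β) ∨ (α ^ p ^ n = β ∧ β ^ p ^ n = α) :=
    hroot _ _ (by rw [hs', hβ]) (by rw [hN', hαβ])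
  have hpow2 : ∀ z : Ω, z ^ p ^ (2 * n) = (z ^ p ^ n) ^ p ^ n := fun z ↦ by
    rw [← pow_mul, ← pow_add, two_mul]
  by_cases hfix : α ^ p ^ n = α ∧ β ^ p ^ n = β
  · obtain ⟨h1, h2⟩ := hfix
    have hA : (((fixedPts Ω (p ^ n)).erase 0 ×ˢ (fixedPts Ω (p ^ n)).erase 0).filter
        fun t ↦ (t.1 + t.2, t.1 * t.2) = (s, N)) = {(α, β), (β, α)} := by
      ext ⟨z, w⟩
      simp only [mem_filter, mem_product, mem_erase, mem_fixedPts_pow hn, Prod.mk.injEq,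
        mem_insert, mem_singleton]
      constructor
      · rintro ⟨_, h3, h4⟩
        exact hroot z w h3 h4
      · rintro (⟨rfl, rfl⟩ | ⟨rfl, rfl⟩)
        · exact ⟨⟨⟨hα0, h1⟩, hβ0, h2⟩, hβ.symm, hαβ.symm⟩
        · exact ⟨⟨⟨hβ0, h2⟩, hα0, h1⟩, by rw [hβ, add_comm], by rw [hαβ, mul_comm]⟩
    have hB : (((fixedPts Ω (p ^ (2 * n))).erase 0).filter
        fun z ↦ (z + z ^ p ^ n, z * z ^ p ^ n) = (s, N)) = if α = β then {α} else ∅ := by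
      ext z
      simp only [mem_filter, mem_erase, mem_fixedPts_pow hn2, Prod.mk.injEq]
      constructor
      · rintro ⟨_, h3, h4⟩
        rcases hroot _ _ h3 h4 with ⟨rfl, h5⟩ | ⟨rfl, h5⟩
        · rw [if_pos (h1.symm.trans h5), mem_singleton]
        · have h6 := h2.symm.trans h5
          rw [if_pos h6.symm, mem_singleton, h6]
      · split_ifs with h3
        · rw [mem_singleton]
          rintro rfl
          rw [hpow2, h1, h1]
          exact ⟨⟨hα0, rfl⟩, by rw [hβ, ← h3], by rw [hαβ, ← h3]⟩
        · simp
    rw [hA, hB]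
    split_ifs with h3
    · simp [h3]
    · rw [card_pair (by simp [h3])]; rfl
  · obtain ⟨h1, h2⟩ := hfrob.resolve_left hfix
    have hne : α ≠ β := fun h ↦ hfix ⟨h1.trans h.symm, h2.trans h⟩
    have hA : (((fixedPts Ω (p ^ n)).erase 0 ×ˢ (fixedPts Ω (p ^ n)).erase 0).filter
        fun t ↦ (t.1 + t.2, t.1 * t.2) = (s, N)) = ∅ := by
      ext ⟨z, w⟩
      simp only [mem_filter, mem_product, mem_erase, mem_fixedPts_pow hn, Prod.mk.injEq,
        notMem_empty, iff_false]
      rintro ⟨⟨⟨_, hz⟩, -, -⟩, h3, h4⟩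
      rcases hroot z w h3 h4 with ⟨rfl, rfl⟩ | ⟨rfl, rfl⟩
      · exact hne (hz.symm.trans h1)
      · exact hne (h2.symm.trans hz)
    have hB : (((fixedPts Ω (p ^ (2 * n))).erase 0).filter
        fun z ↦ (z + z ^ p ^ n, z * z ^ p ^ n) = (s, N)) = {α, β} := by
      ext z
      simp only [mem_filter, mem_erase, mem_fixedPts_pow hn2, Prod.mk.injEq, mem_insert,
        mem_singleton]
      constructor
      · rintro ⟨_, h3, h4⟩
        exact (hroot _ _ h3 h4).imp And.left And.left
      · rintro (rfl | rfl)
        · rw [hpow2, h1, h2]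
          exact ⟨⟨hα0, rfl⟩, hβ.symm, hαβ.symm⟩
        · rw [hpow2, h2, h1]
          exact ⟨⟨hβ0, rfl⟩, by rw [hβ, add_comm], by rw [hαβ, mul_comm]⟩
    rw [hA, hB, card_pair hne]; rfl

lemma sum_pairs_add_sum_conj [IsAlgClosed Ω] [CharP Ω p] [DecidableEq Ω] {n : ℕ} (hn : n ≠ 0)
    (h : Ω × Ω → ℂ) :
    ∑ t ∈ (fixedPts Ω (p ^ n)).erase 0 ×ˢ (fixedPts Ω (p ^ n)).erase 0,
        h (t.1 + t.2, t.1 * t.2) +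
      ∑ z ∈ (fixedPts Ω (p ^ (2 * n))).erase 0, h (z + z ^ p ^ n, z * z ^ p ^ n) =
      2 * ∑ t ∈ fixedPts Ω (p ^ n) ×ˢ (fixedPts Ω (p ^ n)).erase 0, h t := by
  have hn2 : 2 * n ≠ 0 := by omega
  rw [← sum_fiberwise_of_maps_to (g := fun t : Ω × Ω ↦ (t.1 + t.2, t.1 * t.2))
      (t := fixedPts Ω (p ^ n) ×ˢ (fixedPts Ω (p ^ n)).erase 0)
      (s := (fixedPts Ω (p ^ n)).erase 0 ×ˢ (fixedPts Ω (p ^ n)).erase 0),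
    ← sum_fiberwise_of_maps_to (g := fun z : Ω ↦ (z + z ^ p ^ n, z * z ^ p ^ n))
      (t := fixedPts Ω (p ^ n) ×ˢ (fixedPts Ω (p ^ n)).erase 0)
      (s := (fixedPts Ω (p ^ (2 * n))).erase 0), ← sum_add_distrib, mul_sum]
  · refine Finset.sum_congr rfl fun t ht ↦ ?_
    obtain ⟨ht1, ht2⟩ := mem_product.1 ht
    rw [Finset.sum_congr rfl fun x hx ↦ congrArg h (mem_filter.1 hx).2,
      Finset.sum_congr (s₁ := filter _ ((fixedPts Ω (p ^ (2 * n))).erase 0)) rfl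
        fun x hx ↦ congrArg h (mem_filter.1 hx).2, sum_const, sum_const, ← add_smul,
      card_pairs_add_card_conj hn ht1 ht2, two_smul, two_mul]
  · intro z hz
    simp only [mem_product, mem_erase, mem_fixedPts_pow hn, mem_fixedPts_pow hn2] at hz ⊢
    obtain ⟨hz0, hz⟩ := hz
    have hz' : (z ^ p ^ n) ^ p ^ n = z := by rw [← pow_mul, ← pow_add, ← two_mul, hz]
    refine ⟨?_, mul_ne_zero hz0 (pow_ne_zero _ hz0), ?_⟩
    · rw [add_pow_char_pow, hz', add_comm]
    · rw [mul_pow, hz', mul_comm]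
  · rintro ⟨x, y⟩ h
    simp only [mem_product, mem_erase, mem_fixedPts_pow hn] at h ⊢
    obtain ⟨⟨hx0, hx⟩, hy0, hy⟩ := h
    exact ⟨by rw [add_pow_char_pow, hx, hy], mul_ne_zero hx0 hy0, by rw [mul_pow, hx, hy]⟩

end Kloosterman

section Trace

open Polynomial

variable {p : ℕ} [hp : Fact p.Prime] {Ω : Type*} [Field Ω]

lemma frobSum_add [CharP Ω p] (n : ℕ) (z w : Ω) :
    frobSum p n (z + w) = frobSum p n z + frobSum p n w := by
  simp only [frobSum, add_pow_char_pow, sum_add_distrib]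

lemma frobSum_pow_char [CharP Ω p] {n : ℕ} {w : Ω} (hw : w ^ p ^ n = w) :
    frobSum p n w ^ p = frobSum p n w := by
  have h1 := frobSum_add_pow (p := p) 1 n w
  have h2 := frobSum_add_pow (p := p) n 1 w
  have h3 : frobSum p 1 w = w := by simp [frobSum]
  rw [h3, hw] at h1
  rw [h3, pow_one, add_comm 1 n, ← h1, add_comm w] at h2
  exact add_right_cancel h2

lemma exists_frobSum_ne_zero [IsAlgClosed Ω] [CharP Ω p] {n : ℕ} (hn : n ≠ 0) :
    ∃ w ∈ fixedPts Ω (p ^ n), frobSum p n w ≠ 0 := by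
  by_contra! h
  obtain ⟨m, rfl⟩ := Nat.exists_eq_succ_of_ne_zero hn
  set T : Polynomial Ω := ∑ i ∈ range (m + 1), X ^ p ^ i with hT
  have hTd : T.natDegree ≤ p ^ m := natDegree_sum_le_of_forall_le _ _ fun i hi ↦ by
    rw [natDegree_X_pow]
    exact Nat.pow_le_pow_right hp.out.pos (by simp at hi; omega)
  have hT0 : T ≠ 0 := fun h0 ↦ by
    have h1 : T.coeff (p ^ m) = 1 := by
      rw [hT, finsetSum_coeff, Finset.sum_eq_single m]
      · simp
      · intro i _ him
        rw [coeff_X_pow, if_neg fun h ↦ him (Nat.pow_right_injective hp.out.two_le h).symm]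
      · simp
    rw [h0, coeff_zero] at h1
    exact zero_ne_one h1
  have hle : (fixedPts Ω (p ^ (m + 1))).card ≤ T.natDegree :=
    card_le_degree_of_subset_roots fun x hx ↦ (mem_roots hT0).2 (by
      rw [IsRoot.def, hT, eval_finsetSum]
      simpa [frobSum] using h x hx)
  rw [card_fixedPts p hn] at hle
  exact absurd (hle.trans hTd) (Nat.pow_lt_pow_right hp.out.one_lt (Nat.lt_succ_self m)).not_ge

variable [Algebra (ZMod p) Ω]

lemma algebraMap_mem_fixedPts {n : ℕ} (hn : n ≠ 0) (a : ZMod p) :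
    algebraMap (ZMod p) Ω a ∈ fixedPts Ω (p ^ n) := by
  rw [mem_fixedPts_pow hn, algebraMap_pow_char_pow]

lemma image_algebraMap_zmod [IsAlgClosed Ω] [CharP Ω p] [DecidableEq Ω] :
    univ.image (algebraMap (ZMod p) Ω) = fixedPts Ω (p ^ 1) := by
  refine eq_of_subset_of_card_le (fun x hx ↦ ?_) ?_
  · obtain ⟨a, -, rfl⟩ := mem_image.1 hx
    exact algebraMap_mem_fixedPts one_ne_zero a
  · rw [card_fixedPts p one_ne_zero, card_image_of_injective _ (algebraMap (ZMod p) Ω).injective,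
      card_univ, ZMod.card, pow_one]

/-- The trace to `ZMod p` of an element `w` of the field with `p ^ n` elements. -/
noncomputable def frobTr (p n : ℕ) [Fact p.Prime] {Ω : Type*} [Field Ω] [Algebra (ZMod p) Ω]
    (w : Ω) : ZMod p :=
  Function.invFun (algebraMap (ZMod p) Ω) (frobSum p n w)

/-- The standard additive character of the field with `p ^ n` elements. -/
noncomputable def trChar (p n : ℕ) [Fact p.Prime] {Ω : Type*} [Field Ω] [Algebra (ZMod p) Ω]
    (w : Ω) : ℂ :=
  ZMod.stdAddChar (frobTr p n w)

lemma frobTr_eq_of_frobSum_eq {n : ℕ} {w : Ω} {c : ZMod p}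
    (h : frobSum p n w = algebraMap (ZMod p) Ω c) : frobTr p n w = c := by
  rw [frobTr, h, Function.leftInverse_invFun (algebraMap (ZMod p) Ω).injective]

lemma trChar_algebraMap (a : ZMod p) :
    trChar p 1 (algebraMap (ZMod p) Ω a) = ZMod.stdAddChar a := by
  rw [trChar, frobTr_eq_of_frobSum_eq (c := a) (by simp [frobSum])]

lemma trChar_zero (n : ℕ) : trChar p n (0 : Ω) = 1 := by
  rw [trChar, frobTr_eq_of_frobSum_eq (c := 0), AddChar.map_zero_eq_one]
  simp [frobSum, hp.out.ne_zero]

variable [IsAlgClosed Ω] [CharP Ω p]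

lemma algebraMap_frobTr {n : ℕ} {w : Ω} (hw : w ^ p ^ n = w) :
    algebraMap (ZMod p) Ω (frobTr p n w) = frobSum p n w := by
  classical
  have h : frobSum p n w ∈ fixedPts Ω (p ^ 1) := by
    rw [mem_fixedPts_pow one_ne_zero, pow_one, frobSum_pow_char hw]
  rw [← image_algebraMap_zmod] at h
  obtain ⟨a, -, ha⟩ := mem_image.1 h
  rw [frobTr_eq_of_frobSum_eq ha.symm, ha]

lemma trChar_add {n : ℕ} {z w : Ω} (hz : z ^ p ^ n = z) (hw : w ^ p ^ n = w) :
    trChar p n (z + w) = trChar p n z * trChar p n w := by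
  rw [trChar, trChar, trChar, ← AddChar.map_add_eq_mul]
  congr 1
  refine frobTr_eq_of_frobSum_eq ?_
  rw [map_add, algebraMap_frobTr hz, algebraMap_frobTr hw, frobSum_add]

lemma trChar_two_mul {n : ℕ} {z : Ω} (hz : z ^ p ^ (2 * n) = z) :
    trChar p (2 * n) z = trChar p n (z + z ^ p ^ n) := by
  rw [trChar, trChar]
  congr 1
  symm
  refine frobTr_eq_of_frobSum_eq ?_
  rw [algebraMap_frobTr hz, frobSum_add, two_mul, ← frobSum_add_pow]
  congr 1
  simp only [frobSum, sum_pow_char_pow]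
  exact Finset.sum_congr rfl fun i _ ↦ by rw [← pow_mul, ← pow_mul, mul_comm]

lemma sum_trChar_mul {n : ℕ} (hn : n ≠ 0) {u : Ω} (hu0 : u ≠ 0)
    (hu : u ^ p ^ n = u) :
    ∑ s ∈ fixedPts Ω (p ^ n), trChar p n (u * s) = 0 := by
  obtain ⟨w, hw, hw0⟩ := exists_frobSum_ne_zero (p := p) (Ω := Ω) hn
  rw [mem_fixedPts_pow hn] at hw
  have hχ : trChar p n w ≠ 1 := fun h ↦ by
    have h1 : frobTr p n w = 0 := ZMod.injective_stdAddChar (by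
      rw [AddChar.map_zero_eq_one]; exact h)
    rw [← algebraMap_frobTr hw, h1, map_zero] at hw0
    exact hw0 rfl
  have hshift : ∑ s ∈ fixedPts Ω (p ^ n), trChar p n (u * s) =
      trChar p n w * ∑ s ∈ fixedPts Ω (p ^ n), trChar p n (u * s) := by
    rw [mul_sum]
    refine sum_nbij' (fun s ↦ s - u⁻¹ * w) (fun s ↦ s + u⁻¹ * w) ?_ ?_ ?_ ?_ ?_
    · intro s hs
      rw [mem_fixedPts_pow hn] at hs ⊢
      rw [sub_pow_char_pow, mul_pow, inv_pow, hs, hu, hw]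
    · intro s hs
      rw [mem_fixedPts_pow hn] at hs ⊢
      rw [add_pow_char_pow, mul_pow, inv_pow, hs, hu, hw]
    · intro s _; ring
    · intro s _; ring
    · intro s hs
      rw [mem_fixedPts_pow hn] at hs
      have h1 : u * (s - u⁻¹ * w) = u * s - w := by field_simp
      rw [h1, ← trChar_add hw (by rw [sub_pow_char_pow, mul_pow, hs, hu, hw])]
      congr 1
      ring
  by_contra h
  exact hχ (mul_right_cancel₀ h (by rw [one_mul]; exact hshift.symm))

end Trace

section KloostermanSum

variable {p : ℕ} [hp : Fact p.Prime]

/-- The Kloosterman sum over the field with `p ^ n` elements inside `Ω`. -/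
noncomputable def kloostermanSum (p n : ℕ) [Fact p.Prime] (Ω : Type*) [Field Ω] [DecidableEq Ω]
    [Algebra (ZMod p) Ω] (a b : ZMod p) : ℂ :=
  ∑ z ∈ (fixedPts Ω (p ^ n)).erase 0,
    trChar p n (algebraMap (ZMod p) Ω a * z + algebraMap (ZMod p) Ω b * z⁻¹)

variable {Ω : Type*} [Field Ω] [DecidableEq Ω] [Algebra (ZMod p) Ω] [IsAlgClosed Ω] [CharP Ω p]

lemma kloostermanSum_one (a b : ZMod p) :
    kloostermanSum p 1 Ω a b =
      ∑ u ∈ univ.erase (0 : ZMod p), ZMod.stdAddChar (a * u + b * u⁻¹) := by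
  rw [kloostermanSum, ← image_algebraMap_zmod, ← map_zero (algebraMap (ZMod p) Ω),
    ← image_erase (algebraMap (ZMod p) Ω).injective,
    sum_image (algebraMap (ZMod p) Ω).injective.injOn]
  refine Finset.sum_congr rfl fun u _ ↦ ?_
  rw [← trChar_algebraMap (Ω := Ω)]
  simp

lemma sum_trChar_product {n : ℕ} (hn : n ≠ 0) {α β : Ω} (hα0 : α ≠ 0) (hβ0 : β ≠ 0)
    (hα : α ^ p ^ n = α) (hβ : β ^ p ^ n = β) :
    ∑ t ∈ fixedPts Ω (p ^ n) ×ˢ (fixedPts Ω (p ^ n)).erase 0,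
      trChar p n ((α + β * t.2⁻¹) * t.1) = (p : ℂ) ^ n := by
  rw [sum_product_right, Finset.sum_eq_single (-β / α)]
  · have h : α + β * (-β / α)⁻¹ = 0 := by
      rw [inv_div, div_neg, mul_neg, mul_div_cancel₀ _ hβ0, add_neg_cancel]
    simp only [h, zero_mul, trChar_zero, sum_const, card_fixedPts p hn]
    simp
  · intro N hN hne
    simp only [mem_erase, mem_fixedPts_pow hn] at hN
    refine sum_trChar_mul (p := p) (u := α + β * N⁻¹) hn (fun h ↦ hne ?_) ?_
    · rw [eq_div_iff hα0]
      have h1 : (α + β * N⁻¹) * N = α * N + β := by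
        rw [add_mul, inv_mul_cancel_right₀ hN.1]
      rw [h, zero_mul] at h1
      linear_combination -h1
    · rw [add_pow_char_pow, mul_pow, inv_pow, hN.2, hα, hβ]
  · intro h
    refine absurd ?_ h
    simp only [mem_erase, mem_fixedPts_pow hn]
    refine ⟨div_ne_zero (neg_ne_zero.2 hβ0) hα0, ?_⟩
    rw [div_pow, hα, ← neg_one_mul, mul_pow, hβ, neg_one_pow_char_pow]

theorem kloostermanSum_two_mul {n : ℕ} (hn : n ≠ 0) {a b : ZMod p} (ha : a ≠ 0) (hb : b ≠ 0) :
    kloostermanSum p n Ω a b ^ 2 + kloostermanSum p (2 * n) Ω a b = 2 * (p : ℂ) ^ n := by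
  have hn2 : 2 * n ≠ 0 := by omega
  set α := algebraMap (ZMod p) Ω a with hα
  set β := algebraMap (ZMod p) Ω b with hβ
  have hα0 : α ≠ 0 := by simpa [hα] using ha
  have hβ0 : β ≠ 0 := by simpa [hβ] using hb
  have hαq : ∀ i, α ^ p ^ i = α := algebraMap_pow_char_pow a
  have hβq : ∀ i, β ^ p ^ i = β := algebraMap_pow_char_pow b
  have key := sum_pairs_add_sum_conj (p := p) (Ω := Ω) hn
    (fun t ↦ trChar p n ((α + β * t.2⁻¹) * t.1))
  have h1 : ∑ t ∈ (fixedPts Ω (p ^ n)).erase 0 ×ˢ (fixedPts Ω (p ^ n)).erase 0,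
      trChar p n ((α + β * (t.1 * t.2)⁻¹) * (t.1 + t.2)) = kloostermanSum p n Ω a b ^ 2 := by
    rw [sq, kloostermanSum, sum_mul_sum, sum_product]
    refine Finset.sum_congr rfl fun x hx ↦ Finset.sum_congr rfl fun y hy ↦ ?_
    simp only [mem_erase, mem_fixedPts_pow hn] at hx hy
    rw [← trChar_add (by rw [kloostermanArg_pow, hx.2]) (by rw [kloostermanArg_pow, hy.2])]
    congr 1
    have := hx.1
    have := hy.1
    field_simp
    ring
  have h2 : ∑ z ∈ (fixedPts Ω (p ^ (2 * n))).erase 0,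
      trChar p n ((α + β * (z * z ^ p ^ n)⁻¹) * (z + z ^ p ^ n)) =
        kloostermanSum p (2 * n) Ω a b := by
    refine Finset.sum_congr rfl fun z hz ↦ ?_
    simp only [mem_erase, mem_fixedPts_pow hn2] at hz
    rw [trChar_two_mul (by rw [kloostermanArg_pow, hz.2]), kloostermanArg_pow]
    congr 1
    have h3 := hz.1
    have h4 : z ^ p ^ n ≠ 0 := pow_ne_zero _ hz.1
    generalize z ^ p ^ n = w at h4
    field_simp
    ring
  have h3 := sum_trChar_product hn hα0 hβ0 (hαq n) (hβq n)
  rw [← h1, ← h2, ← h3]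
  exact key

lemma norm_kloostermanSum_le (m : ℕ) {a : ZMod p} (b : ZMod p) (ha : a ≠ 0) :
    ‖kloostermanSum p (2 * (m + 1)) Ω a b‖ ≤ 5 * p * (p : ℝ) ^ (m + 1) := by
  set n := 2 * (m + 1) with hn'
  have hn : n ≠ 0 := by omega
  set f : Ω → ZMod p := fun z ↦
    frobTr p n (algebraMap (ZMod p) Ω a * z + algebraMap (ZMod p) Ω b * z⁻¹) with hf
  set s := (fixedPts Ω (p ^ n)).erase 0 with hs
  set M := p ^ m * p ^ (m + 1) + 4 * p ^ (m + 1) with hM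
  have hcard : s.card = p ^ n - 1 := by
    rw [hs, card_erase_of_mem, card_fixedPts p hn]
    rw [mem_fixedPts_pow hn, zero_pow (pow_ne_zero _ hp.out.ne_zero)]
  have hfib : ∀ c : ZMod p, (s.filter fun z ↦ f z = c).card ≤ M := fun c ↦ by
    refine card_le_of_frobSum_eq m b c ha _ fun x hx ↦ ?_
    simp only [hs, mem_filter, mem_erase, mem_fixedPts_pow hn] at hx
    refine ⟨hx.1.1, hx.1.2, ?_⟩
    rw [← hx.2, algebraMap_frobTr (by rw [kloostermanArg_pow, hx.1.2])]
  have hsum : kloostermanSum p n Ω a b =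
      ∑ c : ZMod p, (((s.filter fun z ↦ f z = c).card : ℂ) - M) * ZMod.stdAddChar c := by
    have h0 : ∑ c : ZMod p, (ZMod.stdAddChar c : ℂ) = 0 :=
      AddChar.sum_eq_zero_of_ne_one fun h ↦ by
        have h1 : (1 : ZMod p) = 0 := ZMod.injective_stdAddChar (by rw [h]; simp)
        exact one_ne_zero h1
    simp_rw [sub_mul, sum_sub_distrib, ← mul_sum, h0, mul_zero, sub_zero]
    rw [kloostermanSum, ← sum_fiberwise_of_maps_to (g := f) (t := univ) (fun _ _ ↦ mem_univ _)]
    refine Finset.sum_congr rfl fun c _ ↦ ?_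
    rw [← nsmul_eq_mul, ← sum_const]
    exact Finset.sum_congr rfl fun z hz ↦ by
      rw [trChar]; exact congrArg _ (mem_filter.1 hz).2
  have htot : ∑ c : ZMod p, ((s.filter fun z ↦ f z = c).card : ℝ) = (p : ℝ) ^ n - 1 := by
    have h := card_eq_sum_card_fiberwise (f := f) (s := s) (t := univ) (fun _ _ ↦ by simp)
    rw [← Nat.cast_sum, ← h, hcard, Nat.cast_sub (Nat.one_le_pow _ _ hp.out.pos)]
    simp
  have hp1 : (1 : ℝ) ≤ p := by exact_mod_cast hp.out.one_le
  calc ‖kloostermanSum p n Ω a b‖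
      ≤ ∑ c : ZMod p, ((M : ℝ) - ((s.filter fun z ↦ f z = c).card : ℝ)) := by
        rw [hsum]
        refine norm_sum_le_of_le _ fun c _ ↦ ?_
        rw [norm_mul, AddChar.norm_apply, mul_one, ← norm_neg, neg_sub]
        have h : (M : ℂ) - ((s.filter fun z ↦ f z = c).card : ℂ) =
          (((M - (s.filter fun z ↦ f z = c).card : ℕ) : ℝ) : ℂ) := by
          rw [Nat.cast_sub (hfib c)]; push_cast; rfl
        rw [h, Complex.norm_real, Real.norm_natCast, Nat.cast_sub (hfib c)]
    _ = p * M - ((p : ℝ) ^ n - 1) := by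
        rw [sum_sub_distrib, htot, sum_const, card_univ, ZMod.card, nsmul_eq_mul]
    _ = 4 * p * (p : ℝ) ^ (m + 1) + 1 := by
        rw [hM, hn']; push_cast; ring
    _ ≤ _ := by
        have h1 : (1 : ℝ) ≤ (p : ℝ) ^ (m + 1) := one_le_pow₀ hp1
        nlinarith

/-- Weil's bound for Kloosterman sums over the prime field. -/
theorem norm_kloostermanSum_one_le {a b : ZMod p} (ha : a ≠ 0) (hb : b ≠ 0) :
    ‖kloostermanSum p 1 Ω a b‖ ≤ 2 * √p := by
  by_contra! hlt
  have hp0 : (0 : ℝ) < p := by exact_mod_cast hp.out.pos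
  have hw0 : 0 < √(p : ℝ) := Real.sqrt_pos.2 hp0
  obtain ⟨δ, hδ, hδ'⟩ : ∃ δ > 0, ‖kloostermanSum p 1 Ω a b‖ = (2 + δ) * √p :=
    ⟨‖kloostermanSum p 1 Ω a b‖ / √p - 2, by rw [gt_iff_lt, sub_pos, lt_div_iff₀ hw0]; exact hlt,
      by field_simp; ring⟩
  have hgrow : ∀ k : ℕ,
      (2 + 4 ^ k * δ) * √p ^ 2 ^ k ≤ ‖kloostermanSum p (2 ^ k) Ω a b‖ := by
    intro k
    induction k with
    | zero => simp [hδ']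
    | succ k ih =>
      have h := kloostermanSum_two_mul (p := p) (Ω := Ω) (n := 2 ^ k) (by positivity) ha hb
      rw [← pow_succ'] at h
      have h1 : kloostermanSum p (2 ^ (k + 1)) Ω a b =
        2 * (p : ℂ) ^ 2 ^ k - kloostermanSum p (2 ^ k) Ω a b ^ 2 := by rw [← h]; ring
      have h2 : ‖kloostermanSum p (2 ^ k) Ω a b‖ ^ 2 - 2 * (p : ℝ) ^ 2 ^ k ≤
          ‖kloostermanSum p (2 ^ (k + 1)) Ω a b‖ := by
        rw [h1, norm_sub_rev, ← norm_pow]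
        refine le_trans (le_of_eq ?_) (norm_sub_norm_le _ _)
        simp
      have h3 : √(p : ℝ) ^ 2 ^ (k + 1) = (p : ℝ) ^ 2 ^ k := by
        rw [pow_succ', pow_mul, Real.sq_sqrt hp0.le]
      have h4 := pow_le_pow_left₀ (by positivity) ih 2
      rw [mul_pow, ← pow_mul (√(p : ℝ)), ← pow_succ, h3] at h4
      rw [h3]
      refine le_trans ?_ h2
      refine le_trans ?_ (sub_le_sub_right h4 _)
      have h5 : (0 : ℝ) < (p : ℝ) ^ 2 ^ k := by positivity
      have h6 : 0 ≤ (4 ^ k * δ) ^ 2 * (p : ℝ) ^ 2 ^ k := by positivity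
      rw [pow_succ]
      nlinarith
  obtain ⟨k, hk⟩ := pow_unbounded_of_one_lt (5 * p / δ) (show (1 : ℝ) < 4 by norm_num)
  obtain ⟨m, hm⟩ := Nat.exists_eq_succ_of_ne_zero (show 2 ^ k ≠ 0 by positivity)
  have h1 := hgrow (k + 1)
  have h2 := norm_kloostermanSum_le (p := p) (Ω := Ω) m b ha
  have h3 : √(p : ℝ) ^ 2 ^ (k + 1) = (p : ℝ) ^ (m + 1) := by
    rw [pow_succ', pow_mul, Real.sq_sqrt hp0.le, hm]
  rw [h3, pow_succ' 4, pow_succ' 2, hm] at h1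
  have h4 := le_of_mul_le_mul_right (h1.trans h2) (by positivity)
  rw [div_lt_iff₀ hδ] at hk
  have h5 : 0 < (4 : ℝ) ^ k * δ := by positivity
  nlinarith

end KloostermanSum

section Bilinear

variable {p : ℕ} [hp : Fact p.Prime]

lemma ZMod.sum_stdAddChar_mul (b : ZMod p) :
    ∑ h : ZMod p, (ZMod.stdAddChar (h * b) : ℂ) = if b = 0 then (p : ℂ) else 0 := by
  rw [AddChar.sum_mulShift b (ZMod.isPrimitive_stdAddChar p), ZMod.card]
  split_ifs <;> simp

/-- Parseval's identity. -/
lemma ZMod.sum_norm_sq_sum_mul_stdAddChar (U : Finset (ZMod p)) (a : ZMod p → ℂ) :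
    ∑ h : ZMod p, ‖∑ u ∈ U, a u * ZMod.stdAddChar (h * u)‖ ^ 2 = p * ∑ u ∈ U, ‖a u‖ ^ 2 := by
  have h1 : ∀ h : ZMod p, ((‖∑ u ∈ U, a u * ZMod.stdAddChar (h * u)‖ ^ 2 : ℝ) : ℂ) =
      ∑ u ∈ U, ∑ v ∈ U, a u * starRingEnd ℂ (a v) * ZMod.stdAddChar (h * (u - v)) := by
    intro h
    rw [Complex.ofReal_pow, ← Complex.mul_conj', map_sum, sum_mul_sum]
    refine Finset.sum_congr rfl fun u _ ↦ Finset.sum_congr rfl fun v _ ↦ ?_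
    rw [map_mul (starRingEnd ℂ), ← AddChar.map_neg_eq_conj, mul_sub, sub_eq_add_neg,
      AddChar.map_add_eq_mul]
    ring
  have h2 : ((∑ h : ZMod p, ‖∑ u ∈ U, a u * ZMod.stdAddChar (h * u)‖ ^ 2 : ℝ) : ℂ) =
      ((p * ∑ u ∈ U, ‖a u‖ ^ 2 : ℝ) : ℂ) := by
    rw [Complex.ofReal_sum, Finset.sum_congr rfl fun h _ ↦ h1 h, sum_comm]
    push_cast
    rw [mul_sum]
    refine Finset.sum_congr rfl fun u hu ↦ ?_
    rw [sum_comm]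
    simp_rw [← mul_sum, ZMod.sum_stdAddChar_mul, sub_eq_zero]
    rw [Finset.sum_eq_single u (fun v _ hv ↦ by rw [if_neg hv.symm, mul_zero])
      (fun h ↦ absurd hu h), if_pos rfl, Complex.mul_conj', mul_comm]
  exact_mod_cast h2

/-- A function on `ZMod p` with Fourier transform bounded by `M` defines a convolution operator
of norm at most `M`. -/
lemma ZMod.norm_sum_sum_mul_le {f : ZMod p → ℂ} {M : ℝ}
    (hf : ∀ h, ‖∑ w, f w * ZMod.stdAddChar (-(h * w))‖ ≤ M) (U V : Finset (ZMod p))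
    (a b : ZMod p → ℂ) :
    ‖∑ u ∈ U, ∑ v ∈ V, a u * b v * f (u + v)‖ ≤
      M * (√(∑ u ∈ U, ‖a u‖ ^ 2) * √(∑ v ∈ V, ‖b v‖ ^ 2)) := by
  have hp0 : (0 : ℝ) < p := by exact_mod_cast hp.out.pos
  have hM : 0 ≤ M := (norm_nonneg _).trans (hf 0)
  set F : ZMod p → ℂ := fun h ↦ ∑ w, f w * ZMod.stdAddChar (-(h * w)) with hF
  set α : ZMod p → ℂ := fun h ↦ ∑ u ∈ U, a u * ZMod.stdAddChar (h * u) with hα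
  set β : ZMod p → ℂ := fun h ↦ ∑ v ∈ V, b v * ZMod.stdAddChar (h * v) with hβ
  have hinv : ∀ w, ∑ h, F h * ZMod.stdAddChar (h * w) = p * f w := by
    intro w
    simp only [hF, sum_mul]
    rw [sum_comm]
    have h1 : ∀ w' h : ZMod p, f w' * ZMod.stdAddChar (-(h * w')) * ZMod.stdAddChar (h * w) =
        f w' * ZMod.stdAddChar (h * (w - w')) := fun w' h ↦ by
      rw [mul_assoc, ← AddChar.map_add_eq_mul]
      congr 2
      ring
    simp_rw [h1, ← mul_sum, ZMod.sum_stdAddChar_mul, sub_eq_zero]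
    simp [mul_comm]
  have hsum : (p : ℂ) * ∑ u ∈ U, ∑ v ∈ V, a u * b v * f (u + v) = ∑ h, F h * (α h * β h) := by
    simp only [hα, hβ, sum_mul_sum]
    simp only [mul_sum]
    rw [sum_comm (s := univ)]
    refine Finset.sum_congr rfl fun u _ ↦ ?_
    rw [sum_comm (s := univ)]
    refine Finset.sum_congr rfl fun v _ ↦ ?_
    rw [mul_left_comm, ← hinv, mul_sum]
    refine Finset.sum_congr rfl fun h _ ↦ ?_
    rw [mul_add, AddChar.map_add_eq_mul]
    ring
  have hnorm : p * ‖∑ u ∈ U, ∑ v ∈ V, a u * b v * f (u + v)‖ ≤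
      p * (M * (√(∑ u ∈ U, ‖a u‖ ^ 2) * √(∑ v ∈ V, ‖b v‖ ^ 2))) := by
    calc p * ‖∑ u ∈ U, ∑ v ∈ V, a u * b v * f (u + v)‖
        = ‖∑ h, F h * (α h * β h)‖ := by rw [← hsum, norm_mul, Complex.norm_natCast]
      _ ≤ ∑ h, M * (‖α h‖ * ‖β h‖) := by
          refine norm_sum_le_of_le _ fun h _ ↦ ?_
          rw [norm_mul, norm_mul]
          exact mul_le_mul_of_nonneg_right (hf h) (by positivity)
      _ ≤ M * (√(∑ h, ‖α h‖ ^ 2) * √(∑ h, ‖β h‖ ^ 2)) := by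
          rw [← mul_sum]
          exact mul_le_mul_of_nonneg_left (Real.sum_mul_le_sqrt_mul_sqrt _ _ _) hM
      _ = _ := by
          rw [ZMod.sum_norm_sq_sum_mul_stdAddChar, ZMod.sum_norm_sq_sum_mul_stdAddChar,
            Real.sqrt_mul hp0.le, Real.sqrt_mul hp0.le]
          linear_combination M * √(∑ u ∈ U, ‖a u‖ ^ 2) * √(∑ v ∈ V, ‖b v‖ ^ 2) *
            Real.mul_self_sqrt hp0.le
  exact le_of_mul_le_mul_left hnorm hp0

lemma sqrt_sum_norm_sq_le {ι : Type*} (U : Finset ι) (a : ι → ℂ) {A : ℝ} (hA : 0 ≤ A)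
    (ha : ∀ u ∈ U, ‖a u‖ ≤ A) : √(∑ u ∈ U, ‖a u‖ ^ 2) ≤ A * √U.card := by
  rw [← Real.sqrt_sq hA, ← Real.sqrt_mul (sq_nonneg A)]
  refine Real.sqrt_le_sqrt ?_
  rw [mul_comm, ← nsmul_eq_mul]
  refine sum_le_card_nsmul _ _ _ fun u hu ↦ ?_
  exact pow_le_pow_left₀ (norm_nonneg _) (ha u hu) 2

/-- Weil's bound for possibly degenerate Kloosterman sums. -/
lemma norm_sum_stdAddChar_le (a : ZMod p) {b : ZMod p} (hb : b ≠ 0) :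
    ‖∑ u ∈ univ.erase (0 : ZMod p), (ZMod.stdAddChar (a * u + b * u⁻¹) : ℂ)‖ ≤ 2 * √p := by
  classical
  by_cases ha : a = 0
  · have h1 : ∑ u ∈ univ.erase (0 : ZMod p), (ZMod.stdAddChar (a * u + b * u⁻¹) : ℂ) =
        ∑ u ∈ univ.erase (0 : ZMod p), ZMod.stdAddChar (u * b) := by
      refine sum_nbij' (·⁻¹) (·⁻¹) ?_ ?_ ?_ ?_ ?_ <;> simp [ha, mul_comm]
    have h2 := add_sum_erase univ (fun u : ZMod p ↦ (ZMod.stdAddChar (u * b) : ℂ)) (mem_univ 0)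
    rw [ZMod.sum_stdAddChar_mul, if_neg hb, zero_mul, AddChar.map_zero_eq_one] at h2
    rw [h1, eq_neg_of_add_eq_zero_right h2, norm_neg, norm_one]
    have h3 : (1 : ℝ) ≤ √p := Real.one_le_sqrt.2 (by exact_mod_cast hp.out.one_le)
    linarith
  · have : CharP (AlgebraicClosure (ZMod p)) p :=
      charP_of_injective_algebraMap (algebraMap (ZMod p) _).injective p
    rw [← kloostermanSum_one (Ω := AlgebraicClosure (ZMod p))]
    exact norm_kloostermanSum_one_le ha hb

lemma psi_eq_stdAddChar (x y u : ZMod p) :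
    psi p x y u = if u = 0 then 0 else ZMod.stdAddChar (x * u + y * u⁻¹) := by
  rw [psi, ZMod.stdAddChar_apply, ZMod.toCircle_apply]

lemma norm_sum_psi_mul_stdAddChar_le (x : ZMod p) {y : ZMod p} (hy : y ≠ 0) (h : ZMod p) :
    ‖∑ w, psi p x y w * ZMod.stdAddChar (-(h * w))‖ ≤ 2 * √p := by
  have h1 : ∑ w, psi p x y w * ZMod.stdAddChar (-(h * w)) =
      ∑ u ∈ univ.erase (0 : ZMod p), (ZMod.stdAddChar ((x - h) * u + y * u⁻¹) : ℂ) := by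
    rw [← add_sum_erase univ _ (mem_univ 0), psi_eq_stdAddChar, if_pos rfl, zero_mul, zero_add]
    refine Finset.sum_congr rfl fun u hu ↦ ?_
    rw [psi_eq_stdAddChar, if_neg (ne_of_mem_erase hu), ← AddChar.map_add_eq_mul]
    congr 1
    ring
  rw [h1]
  exact norm_sum_stdAddChar_le _ hy

end Bilinear

theorem stmt_7 :
    ∃ C > (0 : ℝ), ∀ p : ℕ, p.Prime → ∀ (U V : Finset (ZMod p))
      (a b : ZMod p → ℂ) (A B : ℝ),
      (∀ u ∈ U, ‖a u‖ ≤ A) → (∀ v ∈ V, ‖b v‖ ≤ B) →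
      ∀ x y : ZMod p, y ≠ 0 →
      ‖∑ u ∈ U, ∑ v ∈ V, a u * b v * psi p x y (u + v)‖ ≤
        C * A * B * (U.card : ℝ) ^ ((1 : ℝ) / 2) * (V.card : ℝ) ^ ((1 : ℝ) / 2)
          * (p : ℝ) ^ ((1 : ℝ) / 2) := by
  refine ⟨2, two_pos, fun p hp U V a b A B ha hb x y hy ↦ ?_⟩
  have : Fact p.Prime := ⟨hp⟩
  rcases U.eq_empty_or_nonempty with rfl | ⟨u₀, hu₀⟩
  · simp
  rcases V.eq_empty_or_nonempty with rfl | ⟨v₀, hv₀⟩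
  · simp
  have hA : 0 ≤ A := (norm_nonneg _).trans (ha u₀ hu₀)
  have hB : 0 ≤ B := (norm_nonneg _).trans (hb v₀ hv₀)
  simp only [← Real.sqrt_eq_rpow]
  calc ‖∑ u ∈ U, ∑ v ∈ V, a u * b v * psi p x y (u + v)‖
      ≤ 2 * √p * (√(∑ u ∈ U, ‖a u‖ ^ 2) * √(∑ v ∈ V, ‖b v‖ ^ 2)) :=
        ZMod.norm_sum_sum_mul_le (norm_sum_psi_mul_stdAddChar_le x hy) U V a b
    _ ≤ 2 * √p * ((A * √U.card) * (B * √V.card)) := by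
        gcongr
        · exact sqrt_sum_norm_sq_le U a hA ha
        · exact sqrt_sum_norm_sq_le V b hB hb
    _ = _ := by ring
end

section
/- Let p be a prime and k a positive integer with p > k, and let v₁, …, v_k, w₁, …, w_k ∈ 𝔽_p. If, in the field 𝔽_p(X) of rational functions over 𝔽_p, the identity ∑_{r=1}^{k} 1/(X + v_r) = ∑_{s=1}^{k} 1/(X + w_s) holds, then the multiset {v₁, …, v_k} equals the multiset {w₁, …, w_k}, i.e., (w₁, …, w_k) is a permutation of (v₁, …, v_k). -/
theorem eq_zero_of_sum_C_mul_inv_X_add_C_eq_zero {K : Type*} [Field K] [DecidableEq K]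
    (s : Finset K) (c : K → K)
    (h : ∑ a ∈ s, RatFunc.C (c a) * (RatFunc.X + RatFunc.C a)⁻¹ = 0) :
    ∀ a ∈ s, c a = 0 := by
  have key : ∑ a ∈ s, Polynomial.C (c a) *
      ∏ b ∈ s.erase a, (Polynomial.X + Polynomial.C b) = 0 := by
    apply RatFunc.algebraMap_injective K
    have h' := congrArg
      (· * algebraMap (Polynomial K) (RatFunc K) (∏ b ∈ s, (Polynomial.X + Polynomial.C b))) h
    simp only [Finset.sum_mul, zero_mul] at h'
    rw [map_zero, ← h', map_sum]
    refine Finset.sum_congr rfl fun a ha => ?_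
    have hne : (RatFunc.X + RatFunc.C a : RatFunc K) ≠ 0 := by
      rw [← RatFunc.algebraMap_X, ← RatFunc.algebraMap_C, ← map_add]
      exact RatFunc.algebraMap_ne_zero (Polynomial.X_add_C_ne_zero a)
    rw [← Finset.mul_prod_erase s _ ha, map_mul, map_mul, map_add, RatFunc.algebraMap_C,
      RatFunc.algebraMap_X, RatFunc.algebraMap_C, mul_assoc, inv_mul_cancel_left₀ hne]
  intro a ha
  have e := congrArg (Polynomial.eval (-a)) key
  rw [Polynomial.eval_finsetSum, Finset.sum_eq_single_of_mem a ha] at e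
  · simp only [Polynomial.eval_mul, Polynomial.eval_C, Polynomial.eval_prod, Polynomial.eval_add,
      Polynomial.eval_X, Polynomial.eval_zero, mul_eq_zero, Finset.prod_eq_zero_iff] at e
    refine e.resolve_right ?_
    rintro ⟨b, hb, hab⟩
    exact (Finset.mem_erase.1 hb).1 (neg_add_eq_zero.1 hab).symm
  · intro b _ hb
    rw [Polynomial.eval_mul, Polynomial.eval_prod,
      Finset.prod_eq_zero (Finset.mem_erase.2 ⟨hb.symm, ha⟩) (by simp), mul_zero]

theorem sum_inv_X_add_C_eq_sum_card {K ι : Type*} [Field K] [Fintype K] [DecidableEq K]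
    [Fintype ι] (v : ι → K) :
    ∑ r, (RatFunc.X + RatFunc.C (v r))⁻¹ =
      ∑ a, RatFunc.C ((Finset.univ.filter (v · = a)).card : K) *
        (RatFunc.X + RatFunc.C a)⁻¹ := by
  rw [← Finset.sum_fiberwise' Finset.univ v fun a => (RatFunc.X + RatFunc.C a)⁻¹]
  simp

theorem stmt_9 (p : ℕ) [Fact p.Prime] (k : ℕ) (hk : 0 < k) (hkp : k < p)
    (v w : Fin k → ZMod p)
    (h : ∑ r : Fin k, (RatFunc.X + RatFunc.C (v r))⁻¹
        = ∑ s : Fin k, (RatFunc.X + RatFunc.C (w s))⁻¹) :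
    ∃ σ : Equiv.Perm (Fin k), w = v ∘ σ := by
  rw [sum_inv_X_add_C_eq_sum_card, sum_inv_X_add_C_eq_sum_card, ← sub_eq_zero,
    ← Finset.sum_sub_distrib] at h
  simp only [← sub_mul, ← map_sub] at h
  have hlt (u : Fin k → ZMod p) (a : ZMod p) : (Finset.univ.filter (u · = a)).card < p :=
    (Finset.card_le_univ _).trans_lt (by simpa using hkp)
  have hcard (a : ZMod p) :
      (Finset.univ.filter (w · = a)).card = (Finset.univ.filter (v · = a)).card := by
    have := sub_eq_zero.1 (eq_zero_of_sum_C_mul_inv_X_add_C_eq_zero _ _ h a (Finset.mem_univ a))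
    rw [ZMod.natCast_eq_natCast_iff] at this
    exact (this.eq_of_lt_of_lt (hlt v a) (hlt w a)).symm
  have hequiv (a : ZMod p) : Nonempty ({i // w i = a} ≃ {i // v i = a}) :=
    Fintype.card_eq.1 (by simpa only [Fintype.card_subtype] using hcard a)
  exact ⟨Equiv.ofFiberEquiv fun a => (hequiv a).some,
    funext fun i => (Equiv.ofFiberEquiv_map _ i).symm⟩
end
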